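/- Let (E, {f_i}_{i=1}^m) ∈ 𝓔. Then dim_H U_1(E) < dim_H E. Furthermore, 0 < H^{dim_H E}(E) < ∞, where H^s denotes the s-dimensional Hausdorff measure. -/

import Mathlib

open Set Filter MeasureTheory

/-- A self-similar iterated function system on `ℝ` given by `m` similitudes
`f i x = r i * x + t i` (for `1 ≤ i ≤ m`, `m ≥ 3`), together with its attractor `E`:
the unique nonempty compact set with `E = ⋃_{i=1}^m f_i(E)`. -/
structure ClassE where
  m : ℕ
  r : ℕ → ℝ
  t : ℕ → ℝ
  E : Set ℝ
  hm : 3 ≤ m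
  hr : ∀ i, 1 ≤ i → i ≤ m → 0 < r i ∧ r i < 1
  hEne : E.Nonempty
  hEcpt : IsCompact E
  hEinv : E = ⋃ i ∈ Finset.Icc 1 m, (fun x => r i * x + t i) '' E

namespace ClassE

/-- The `i`-th similitude. -/
def f (S : ClassE) (i : ℕ) (x : ℝ) : ℝ := S.r i * x + S.t i

/-- Left endpoint `a` of the convex hull of `E`. -/
noncomputable def a (S : ClassE) : ℝ := sInf S.E

/-- Right endpoint `b` of the convex hull of `E`. -/
noncomputable def b (S : ClassE) : ℝ := sSup S.E

/-- The convex hull `I = [a, b]` of `E`. -/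
noncomputable def I (S : ClassE) : Set ℝ := Set.Icc S.a S.b

/-- Condition (A): `a = f_1(a) < f_2(a) < ⋯ < f_m(a) < f_m(b) = b`. -/
def condA (S : ClassE) : Prop :=
  S.f 1 S.a = S.a ∧ (∀ i, 1 ≤ i → i < S.m → S.f i S.a < S.f (i + 1) S.a) ∧
    S.f S.m S.a < S.f S.m S.b ∧ S.f S.m S.b = S.b

/-- Condition (B): `f_i(I) ∩ f_{i+2}(I) = ∅` for all `1 ≤ i ≤ m - 2`. -/
def condB (S : ClassE) : Prop :=
  ∀ i, 1 ≤ i → i + 2 ≤ S.m → S.f i '' S.I ∩ S.f (i + 2) '' S.I = ∅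

/-- Condition (C): there are `i, j ∈ {1, …, m-1}` with `f_i(I) ∩ f_{i+1}(I) = ∅` and
`f_j(I) ∩ f_{j+1}(I) ≠ ∅`. -/
def condC (S : ClassE) : Prop :=
  (∃ i, 1 ≤ i ∧ i + 1 ≤ S.m ∧ S.f i '' S.I ∩ S.f (i + 1) '' S.I = ∅) ∧
    (∃ j, 1 ≤ j ∧ j + 1 ≤ S.m ∧ S.f j '' S.I ∩ S.f (j + 1) '' S.I ≠ ∅)

/-- Condition (D): whenever `f_i(I) ∩ f_{i+1}(I) ≠ ∅` there are `u, v ≥ 1` with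
`f_i(I) ∩ f_{i+1}(I) = f_i ∘ f_m^u (I) = f_{i+1} ∘ f_1^v (I)`. -/
def condD (S : ClassE) : Prop :=
  ∀ i, 1 ≤ i → i + 1 ≤ S.m → S.f i '' S.I ∩ S.f (i + 1) '' S.I ≠ ∅ →
    ∃ u v : ℕ, 1 ≤ u ∧ 1 ≤ v ∧
      S.f i '' S.I ∩ S.f (i + 1) '' S.I = (S.f i ∘ (S.f S.m)^[u]) '' S.I ∧
      S.f i '' S.I ∩ S.f (i + 1) '' S.I = (S.f (i + 1) ∘ (S.f 1)^[v]) '' S.I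

/-- Membership in the class `𝓔`: conditions (A)–(D). -/
def goodE (S : ClassE) : Prop := S.condA ∧ S.condB ∧ S.condC ∧ S.condD

/-- `prefixMap d n = f_{d 0} ∘ f_{d 1} ∘ ⋯ ∘ f_{d (n-1)}`. -/
def prefixMap (S : ClassE) (d : ℕ → ℕ) : ℕ → ℝ → ℝ
  | 0 => id
  | n + 1 => S.prefixMap d n ∘ S.f (d n)

/-- `d : ℕ → ℕ` (with digits in `{1, …, m}`) is a coding of `x` if
`x = lim_n f_{d 0} ∘ ⋯ ∘ f_{d (n-1)} (0)`. -/
def isCoding (S : ClassE) (d : ℕ → ℕ) (x : ℝ) : Prop :=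
  (∀ n, 1 ≤ d n ∧ d n ≤ S.m) ∧
    Tendsto (fun n => S.prefixMap d n 0) atTop (nhds x)

/-- The set of codings of `x`. -/
def codings (S : ClassE) (x : ℝ) : Set (ℕ → ℕ) := {d | S.isCoding d x}

/-- `U k E`: the set of points of `E` having exactly `k` distinct codings
(`k` a cardinal; e.g. `k = ℵ₀` for countably infinitely many codings,
`k = 𝔠 = 2^ℵ₀` for a continuum of codings). -/
def U (S : ClassE) (k : Cardinal) : Set ℝ :=
  {x ∈ S.E | Cardinal.mk (S.codings x) = k}

end ClassE

open ClassE

/-- Finite covers bound Hausdorff measure from above. -/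
theorem aux_H (F : Set ℝ) (t M : ℝ) (ht : 0 ≤ t)
    (h : ∀ η : ℝ, 0 < η → ∃ (κ : Type) (_ : Fintype κ) (V : κ → Set ℝ) (d : κ → ℝ),
      (∀ k, 0 ≤ d k ∧ d k ≤ η) ∧ (∀ k, ∀ x ∈ V k, ∀ y ∈ V k, |x - y| ≤ d k) ∧
      F ⊆ ⋃ k, V k ∧ ∑ k, d k ^ t ≤ M) : μH[t] F ≤ ENNReal.ofReal M := by
  have hp : ∀ n : ℕ, (0:ℝ) < 1 / ((n:ℝ) + 1) := fun n => by positivity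
  choose κ hκ V d h1 h2 h3 h4 using fun n : ℕ => h (1 / ((n:ℝ) + 1)) (hp n)
  have hd : ∀ n k, Metric.ediam (V n k) ≤ ENNReal.ofReal (d n k) := by
    intro n k
    apply Metric.ediam_le
    intro x hx y hy
    rw [edist_dist, Real.dist_eq]
    exact ENNReal.ofReal_le_ofReal (h2 n k x hx y hy)
  have key := Measure.hausdorffMeasure_le_liminf_sum t F (l := atTop)
    (fun n : ℕ => ENNReal.ofReal (1 / ((n:ℝ) + 1)))
    (by
      have := ENNReal.tendsto_ofReal (tendsto_one_div_add_atTop_nhds_zero_nat (𝕜 := ℝ))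
      simpa using this) V
    (Eventually.of_forall fun n k => (hd n k).trans (ENNReal.ofReal_le_ofReal (h1 n k).2))
    (Eventually.of_forall h3)
  refine key.trans ?_
  have : ∀ n, ∑ i, Metric.ediam (V n i) ^ t ≤ ENNReal.ofReal M := by
    intro n
    refine le_trans ?_ (ENNReal.ofReal_le_ofReal (h4 n))
    rw [ENNReal.ofReal_sum_of_nonneg (fun i _ => Real.rpow_nonneg (h1 n i).1 _)]
    refine Finset.sum_le_sum fun i _ => ?_
    rw [← ENNReal.ofReal_rpow_of_nonneg (h1 n i).1 ht]
    exact ENNReal.rpow_le_rpow (hd n i) ht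
  calc _ ≤ liminf (fun _ : ℕ => ENNReal.ofReal M) atTop :=
        liminf_le_liminf (Eventually.of_forall this)
    _ = _ := by simp

/-- Null compact sets have good finite covers. -/
theorem aux_K (F : Set ℝ) (hF : IsCompact F) (s : ℝ) (hs : 0 < s) (h0 : μH[s] F = 0)
    (η : ℝ) (hη : 0 < η) : ∃ (K : Finset ℕ) (V : ℕ → Set ℝ) (e : ℕ → ℝ),
      (∀ k, 0 < e k) ∧ (∀ k, ∀ x ∈ V k, ∀ y ∈ V k, |x - y| ≤ e k) ∧
      F ⊆ ⋃ k ∈ K, V k ∧ ∑ k ∈ K, e k ^ s < η := by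
  rw [Measure.hausdorffMeasure_apply] at h0
  have h1 := (ENNReal.iSup_eq_zero.1 (ENNReal.iSup_eq_zero.1 h0 1)) one_pos
  have h2 : (⨅ (t : ℕ → Set ℝ) (_ : F ⊆ ⋃ n, t n) (_ : ∀ n, Metric.ediam (t n) ≤ 1),
      ∑' n, ⨆ _ : (t n).Nonempty, Metric.ediam (t n) ^ s) < ENNReal.ofReal (η / 2) := by
    rw [h1]; simpa using hη
  simp only [iInf_lt_iff] at h2
  obtain ⟨t, ht, htd, hsum⟩ := h2
  have hdiam : ∀ n, (⨆ _ : (t n).Nonempty, Metric.ediam (t n) ^ s) =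
      ENNReal.ofReal ((Metric.diam (t n)) ^ s) := by
    intro n
    rw [← ENNReal.ofReal_rpow_of_nonneg Metric.diam_nonneg hs.le, Metric.diam,
      ENNReal.ofReal_toReal (ne_top_of_le_ne_top ENNReal.one_ne_top (htd n))]
    rcases (t n).eq_empty_or_nonempty with h | h
    · simp [h, hs]
    · simp [h]
  simp only [hdiam] at hsum
  have hex : ∀ n : ℕ, ∃ e : ℝ, Metric.diam (t n) < e ∧
      e ^ s < Metric.diam (t n) ^ s + η / 2 / 2 / 2 ^ n := by
    intro n
    have hc : ContinuousAt (fun x : ℝ => x ^ s) (Metric.diam (t n)) :=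
      Real.continuousAt_rpow_const _ _ (Or.inr hs.le)
    have hlt : Metric.diam (t n) ^ s < Metric.diam (t n) ^ s + η / 2 / 2 / 2 ^ n := by
      have : 0 < η / 2 / 2 / 2 ^ n := by positivity
      linarith
    have h3 := (hc.tendsto.eventually (gt_mem_nhds hlt))
    have h4 : ∀ᶠ x in nhdsWithin (Metric.diam (t n)) (Ioi (Metric.diam (t n))),
      x ^ s < Metric.diam (t n) ^ s + η / 2 / 2 / 2 ^ n := nhdsWithin_le_nhds h3
    obtain ⟨x, hx1, hx2⟩ := (h4.and self_mem_nhdsWithin).exists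
    exact ⟨x, hx2, hx1⟩
  choose e he1 he2 using hex
  let V : ℕ → Set ℝ := fun n => Metric.thickening ((e n - Metric.diam (t n)) / 2) (t n)
  have hVo : ∀ n, IsOpen (V n) := fun n => Metric.isOpen_thickening
  have hcov : F ⊆ ⋃ n, V n := by
    refine ht.trans (iUnion_mono fun n => Metric.self_subset_thickening ?_ _)
    linarith [he1 n]
  obtain ⟨K, hK⟩ := hF.elim_finite_subcover V hVo hcov
  have he0 : ∀ n, 0 < e n := fun n => lt_of_le_of_lt Metric.diam_nonneg (he1 n)
  refine ⟨K, V, e, he0, ?_, hK, ?_⟩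
  · intro k x hx y hy
    have hb : Bornology.IsBounded (t k) :=
      Metric.isBounded_iff_ediam_ne_top.2 (ne_top_of_le_ne_top ENNReal.one_ne_top (htd k))
    have h5 : dist x y ≤ Metric.diam (V k) := Metric.dist_le_diam_of_mem hb.thickening hx hy
    have h6 := Metric.diam_thickening_le (t k) (ε := (e k - Metric.diam (t k)) / 2)
      (by linarith [he1 k])
    rw [← Real.dist_eq]
    have : Metric.diam (V k) ≤ Metric.diam (t k) + 2 * ((e k - Metric.diam (t k)) / 2) := h6
    linarith
  · have h7 : ∑ k ∈ K, e k ^ s ≤ ∑ k ∈ K, Metric.diam (t k) ^ s + ∑ k ∈ K, η / 2 / 2 / 2 ^ k := by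
      rw [← Finset.sum_add_distrib]
      exact Finset.sum_le_sum fun k _ => (he2 k).le
    have h8 : ∑ k ∈ K, η / 2 / 2 / 2 ^ k ≤ η / 2 := by
      have := (hasSum_geometric_two' (η / 2))
      exact sum_le_hasSum K (fun i _ => by positivity) this
    have h9 : ∑ k ∈ K, Metric.diam (t k) ^ s < η / 2 := by
      have : ENNReal.ofReal (∑ k ∈ K, Metric.diam (t k) ^ s) < ENNReal.ofReal (η / 2) := by
        rw [ENNReal.ofReal_sum_of_nonneg (fun i _ => Real.rpow_nonneg Metric.diam_nonneg _)]
        exact (ENNReal.sum_le_tsum K).trans_lt hsum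
      exact (ENNReal.ofReal_lt_ofReal_iff (by positivity)).1 this
    linarith

theorem aux_L0 {ι : Type} [Fintype ι] [Nontrivial ι] (E : Set ℝ) (hE : E.Nonempty)
    (h : ι → ℝ → ℝ) (ρ : ι → ℝ) (hρ : ∀ j, 0 < ρ j)
    (hexp : ∀ j x y, ρ j * |x - y| ≤ |h j x - h j y|) (hE2 : ∀ j, ∀ x ∈ E, h j x ∈ E)
    (gap : ℝ) (hg : 0 < gap) (hgap : ∀ j k, j ≠ k → ∀ x ∈ E, ∀ y ∈ E, gap ≤ |h j x - h k y|)
    (t : ℝ) (ht : 0 ≤ t) (hsum : 1 ≤ ∑ j, ρ j ^ t) :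
    ∀ (n : ℕ) (K : Finset ℕ) (V : ℕ → Set ℝ) (e : ℕ → ℝ), K.card = n →
      (∀ k, 0 < e k) → (∀ k, ∀ x ∈ V k, ∀ y ∈ V k, |x - y| ≤ e k) →
      E ⊆ ⋃ k ∈ K, V k → gap ^ t ≤ ∑ k ∈ K, e k ^ t := by
  classical
  intro n
  induction n using Nat.strong_induction_on with
  | _ n ih =>
  intro K V e hn he hV hcov
  by_cases hbig : ∃ k ∈ K, gap ≤ e k
  · obtain ⟨k, hk, hge⟩ := hbig
    calc gap ^ t ≤ e k ^ t := Real.rpow_le_rpow hg.le hge ht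
      _ ≤ _ := Finset.single_le_sum (f := fun k => e k ^ t)
        (fun i _ => Real.rpow_nonneg (he i).le _) hk
  push Not at hbig
  let A : ι → Finset ℕ := fun j => K.filter (fun k => ∃ x ∈ E, h j x ∈ V k)
  have hdisj : ∀ i j, i ≠ j → Disjoint (A i) (A j) := by
    intro i j hij
    rw [Finset.disjoint_left]
    intro k hk1 hk2
    simp only [A, Finset.mem_filter] at hk1 hk2
    obtain ⟨hkK, x, hx, hxV⟩ := hk1
    obtain ⟨-, y, hy, hyV⟩ := hk2
    have := hgap i j hij x hx y hy
    have h2 := hV k _ hxV _ hyV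
    linarith [hbig k hkK]
  have hAne : ∀ j, (A j).Nonempty := by
    intro j
    obtain ⟨x, hx⟩ := hE
    have := hcov (hE2 j x hx)
    simp only [mem_iUnion] at this
    obtain ⟨k, hk, hxk⟩ := this
    exact ⟨k, by simp only [A, Finset.mem_filter]; exact ⟨hk, x, hx, hxk⟩⟩
  have hA : ∀ j, ρ j ^ t * gap ^ t ≤ ∑ k ∈ A j, e k ^ t := by
    intro j
    obtain ⟨j', hj'⟩ := exists_ne j
    have hlt : (A j).card < n := by
      rw [← hn]
      apply Finset.card_lt_card
      refine ⟨Finset.filter_subset _ _, fun hsub => ?_⟩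
      obtain ⟨k, hk⟩ := hAne j'
      exact Finset.disjoint_left.1 (hdisj j' j hj') hk (hsub (Finset.filter_subset _ _ hk))
    have := ih _ hlt (A j) (fun k => h j ⁻¹' V k) (fun k => e k / ρ j) rfl
      (fun k => div_pos (he k) (hρ j))
      (by
        intro k x hx y hy
        rw [le_div_iff₀ (hρ j)]
        have h1 := hexp j x y
        have h2 := hV k _ hx _ hy
        linarith)
      (by
        intro x hx
        have := hcov (hE2 j x hx)
        simp only [mem_iUnion] at this ⊢
        obtain ⟨k, hk, hxk⟩ := this
        exact ⟨k, by simp only [A, Finset.mem_filter]; exact ⟨hk, x, hx, hxk⟩, hxk⟩)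
    have h3 : ∑ k ∈ A j, (e k / ρ j) ^ t = (∑ k ∈ A j, e k ^ t) / ρ j ^ t := by
      rw [Finset.sum_div]
      exact Finset.sum_congr rfl fun k _ => Real.div_rpow (he k).le (hρ j).le t
    rw [h3, le_div_iff₀ (Real.rpow_pos_of_pos (hρ j) t)] at this
    linarith
  calc gap ^ t ≤ (∑ j, ρ j ^ t) * gap ^ t :=
        le_mul_of_one_le_left (Real.rpow_nonneg hg.le _) hsum
    _ = ∑ j, ρ j ^ t * gap ^ t := Finset.sum_mul _ _ _
    _ ≤ ∑ j, ∑ k ∈ A j, e k ^ t := Finset.sum_le_sum fun j _ => hA j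
    _ = ∑ k ∈ Finset.univ.biUnion A, e k ^ t :=
        (Finset.sum_biUnion (fun i _ j _ hij => hdisj i j hij)).symm
    _ ≤ _ := Finset.sum_le_sum_of_subset_of_nonneg
        (Finset.biUnion_subset.2 fun j _ => Finset.filter_subset _ _)
        (fun i _ _ => Real.rpow_nonneg (he i).le _)

theorem aux_L {ι : Type} [Fintype ι] [Nontrivial ι] (E : Set ℝ) (hE : E.Nonempty)
    (hEc : IsCompact E)
    (h : ι → ℝ → ℝ) (ρ : ι → ℝ) (hρ : ∀ j, 0 < ρ j)
    (hexp : ∀ j x y, ρ j * |x - y| ≤ |h j x - h j y|) (hE2 : ∀ j, ∀ x ∈ E, h j x ∈ E)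
    (gap : ℝ) (hg : 0 < gap) (hgap : ∀ j k, j ≠ k → ∀ x ∈ E, ∀ y ∈ E, gap ≤ |h j x - h k y|)
    (t : ℝ) (ht : 0 < t) (hsum : 1 ≤ ∑ j, ρ j ^ t) : μH[t] E ≠ 0 := by
  intro h0
  obtain ⟨K, V, e, h1, h2, h3, h4⟩ := aux_K E hEc t ht h0 (gap ^ t) (Real.rpow_pos_of_pos hg t)
  have := aux_L0 E hE h ρ hρ hexp hE2 gap hg hgap t ht.le hsum _ K V e rfl h1 h2 h3
  linarith

theorem aux_Q (F : Set ℝ) (hF : Bornology.IsBounded F) (K : Finset ℕ) (h : ℕ → ℝ → ℝ)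
    (L : ℕ → ℝ) (hL0 : ∀ k ∈ K, 0 < L k) (hL1 : ∀ k ∈ K, L k < 1)
    (hlip : ∀ k ∈ K, ∀ x y, |h k x - h k y| ≤ L k * |x - y|)
    (hcov : F ⊆ ⋃ k ∈ K, h k '' F) (t : ℝ) (ht : 0 < t) (hsum : ∑ k ∈ K, L k ^ t ≤ 1) :
    μH[t] F < ⊤ := by
  classical
  obtain ⟨D0, hD0⟩ := Metric.isBounded_iff.1 hF
  set D := max D0 1
  have hDpos : 0 < D := lt_max_of_lt_right one_pos
  have hD : ∀ x ∈ F, ∀ y ∈ F, |x - y| ≤ D := fun x hx y hy => by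
    rw [← Real.dist_eq]; exact (hD0 hx hy).trans (le_max_left _ _)
  obtain ⟨q, hq0, hq1, hLq⟩ : ∃ q : ℝ, 0 ≤ q ∧ q < 1 ∧ ∀ k ∈ K, L k ≤ q := by
    rcases K.eq_empty_or_nonempty with rfl | hne
    · exact ⟨0, le_rfl, one_pos, by simp⟩
    · refine ⟨K.sup' hne L, ?_, ?_, fun k hk => Finset.le_sup' L hk⟩
      · obtain ⟨k, hk⟩ := hne
        exact (hL0 k hk).le.trans (Finset.le_sup' L hk)
      · rw [Finset.sup'_lt_iff]; exact hL1
  have main : ∀ n : ℕ, ∃ (κ : Type) (_ : Fintype κ) (V : κ → Set ℝ) (d : κ → ℝ),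
      (∀ k, 0 ≤ d k ∧ d k ≤ D * q ^ n) ∧ (∀ k, ∀ x ∈ V k, ∀ y ∈ V k, |x - y| ≤ d k) ∧
      F ⊆ ⋃ k, V k ∧ ∑ k, d k ^ t ≤ D ^ t := by
    intro n
    induction n with
    | zero =>
      refine ⟨Unit, inferInstance, fun _ => F, fun _ => D, ?_, ?_, ?_, ?_⟩
      · intro _; simp [hDpos.le]
      · intro _; exact hD
      · intro x hx; simpa using hx
      · simp
    | succ n ih =>
      obtain ⟨κ, hκ, V, d, h1, h2, h3, h4⟩ := ih
      refine ⟨K × κ, inferInstance, fun p => h p.1 '' V p.2, fun p => L p.1 * d p.2, ?_, ?_, ?_, ?_⟩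
      · rintro ⟨⟨k, hk⟩, j⟩
        refine ⟨mul_nonneg (hL0 k hk).le (h1 j).1, ?_⟩
        calc L k * d j ≤ q * (D * q ^ n) := mul_le_mul (hLq k hk) (h1 j).2 (h1 j).1 hq0
          _ = _ := by ring
      · rintro ⟨⟨k, hk⟩, j⟩ _ ⟨x, hx, rfl⟩ _ ⟨y, hy, rfl⟩
        exact (hlip k hk x y).trans (mul_le_mul_of_nonneg_left (h2 j x hx y hy) (hL0 k hk).le)
      · intro x hx
        have := hcov hx
        simp only [mem_iUnion] at this
        obtain ⟨k, hk, y, hy, rfl⟩ := this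
        obtain ⟨j, hj⟩ := mem_iUnion.1 (h3 hy)
        exact mem_iUnion.2 ⟨(⟨k, hk⟩, j), y, hj, rfl⟩
      · have : ∀ p : K × κ, (L p.1 * d p.2) ^ t = L p.1 ^ t * d p.2 ^ t := fun p =>
          Real.mul_rpow (hL0 p.1 p.1.2).le (h1 p.2).1
        simp only [this]
        rw [Fintype.sum_prod_type]
        simp only [← Finset.mul_sum]
        rw [← Finset.sum_mul]
        have e1 : ∑ i : K, L i ^ t = ∑ k ∈ K, L k ^ t := Finset.sum_coe_sort K (fun k => L k ^ t)
        rw [e1]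
        have h5 : 0 ≤ ∑ i, d i ^ t := Finset.sum_nonneg fun i _ => Real.rpow_nonneg (h1 i).1 _
        calc _ ≤ 1 * ∑ i, d i ^ t := mul_le_mul_of_nonneg_right hsum h5
          _ ≤ _ := by rw [one_mul]; exact h4
  refine (aux_H F t (D ^ t) ht.le fun η hη => ?_).trans_lt ENNReal.ofReal_lt_top
  obtain ⟨n, hn⟩ := exists_pow_lt_of_lt_one (div_pos hη hDpos) hq1
  obtain ⟨κ, hκ, V, d, h1, h2⟩ := main n
  refine ⟨κ, hκ, V, d, fun k => ⟨(h1 k).1, (h1 k).2.trans ?_⟩, h2⟩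
  rw [lt_div_iff₀ hDpos] at hn
  linarith

theorem aux_P (F : Set ℝ) (hF : IsCompact F) (C : ℝ) (hC : 0 < C)
    (hexp : ∀ U ⊆ F, ∀ ε : ℝ, 0 < ε → (∀ x ∈ U, ∀ y ∈ U, |x - y| ≤ ε) →
      ∃ h : ℝ → ℝ, (∀ x y, |h x - h y| ≤ C * ε * |x - y|) ∧ U ⊆ h '' F)
    (s : ℝ) (hs : 0 < s) (h0 : μH[s] F = 0) : dimH F < ENNReal.ofReal s := by
  obtain ⟨K, V, e, h1, h2, h3, h4⟩ := aux_K F hF s hs h0 ((C ^ s)⁻¹)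
    (inv_pos.2 (Real.rpow_pos_of_pos hC s))
  have h5 : ∑ k ∈ K, (C * e k) ^ s < 1 := by
    have : ∑ k ∈ K, (C * e k) ^ s = C ^ s * ∑ k ∈ K, e k ^ s := by
      rw [Finset.mul_sum]
      exact Finset.sum_congr rfl fun k _ => Real.mul_rpow hC.le (h1 k).le
    rw [this]
    calc _ < C ^ s * (C ^ s)⁻¹ := mul_lt_mul_of_pos_left h4 (Real.rpow_pos_of_pos hC s)
      _ = 1 := mul_inv_cancel₀ (Real.rpow_pos_of_pos hC s).ne'
  have hpos : ∀ k, 0 < C * e k := fun k => mul_pos hC (h1 k)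
  have hcont : ContinuousAt (fun t : ℝ => ∑ k ∈ K, (C * e k) ^ t) s := by
    apply Continuous.continuousAt
    exact continuous_finsetSum _ fun k _ => Real.continuous_const_rpow (hpos k).ne'
  have hev : ∀ᶠ t in nhdsWithin s (Iio s), ∑ k ∈ K, (C * e k) ^ t < 1 ∧ 0 < t :=
    nhdsWithin_le_nhds ((hcont.tendsto.eventually (gt_mem_nhds h5)).and (lt_mem_nhds hs))
  obtain ⟨t, ⟨ht1, ht0⟩, hts⟩ := (hev.and self_mem_nhdsWithin).exists
  choose h hh1 hh2 using fun k => hexp (V k ∩ F) inter_subset_right (e k) (h1 k)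
    (fun x hx y hy => h2 k x hx.1 y hy.1)
  have hfin := aux_Q F hF.isBounded K h (fun k => C * e k) (fun k _ => hpos k)
    (fun k hk => by
      have h6 : (C * e k) ^ t < 1 := lt_of_le_of_lt (Finset.single_le_sum
        (f := fun k => (C * e k) ^ t) (fun i _ => Real.rpow_nonneg (hpos i).le _) hk) ht1
      by_contra hcon
      push Not at hcon
      exact absurd (Real.one_le_rpow hcon ht0.le) (not_le.2 h6))
    (fun k _ x y => hh1 k x y)
    (fun x hx => by
      have := h3 hx
      simp only [mem_iUnion] at this ⊢
      obtain ⟨k, hk, hxk⟩ := this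
      exact ⟨k, hk, hh2 k ⟨hxk, hx⟩⟩)
    t ht0 ht1.le
  have h7 : dimH F ≤ (Real.toNNReal t : ENNReal) := by
    apply dimH_le_of_hausdorffMeasure_ne_top
    rw [Real.coe_toNNReal _ ht0.le]
    exact hfin.ne
  exact h7.trans_lt ((ENNReal.ofReal_lt_ofReal_iff hs).2 hts)

theorem aux_fin (E : Set ℝ) (hE : E.Nonempty) (hEc : IsCompact E) (c : ℝ) (hc : 0 < c)
    (hc1 : c ≤ 1)
    (hcyl : ∀ x ∈ E, ∀ δ : ℝ, 0 < δ → δ ≤ 1 → ∃ (h : ℝ → ℝ) (ρ : ℝ), c * δ ≤ ρ ∧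
      (∀ y z, ρ * |y - z| ≤ |h y - h z|) ∧ (∀ y ∈ E, h y ∈ E) ∧ ∀ y ∈ E, |h y - x| ≤ δ)
    (s : ℝ) (hs : 0 < s) (hz : ∀ t, s < t → μH[t] E = 0) : μH[s] E < ⊤ := by
  classical
  have claim : ∀ δ : ℝ, 0 < δ → δ ≤ 1 → ∀ A : Finset ℝ, (∀ x ∈ A, x ∈ E) →
      (∀ x ∈ A, ∀ y ∈ A, x ≠ y → 3 * δ ≤ |x - y|) → (A.card : ℝ) * (c * δ) ^ s ≤ 1 := by
    intro δ hδ hδ1 A hA hsep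
    have hcδ : 0 < c * δ := mul_pos hc hδ
    have hcδ1 : c * δ ≤ 1 := mul_le_one₀ hc1 hδ.le hδ1
    by_cases hcard : A.card ≤ 1
    · calc (A.card : ℝ) * (c * δ) ^ s ≤ 1 * 1 :=
          mul_le_mul (by exact_mod_cast hcard) (Real.rpow_le_one hcδ.le hcδ1 hs.le)
            (Real.rpow_nonneg hcδ.le _) zero_le_one
        _ = 1 := one_mul 1
    push Not at hcard
    by_contra hcon
    push Not at hcon
    have hcont : ContinuousAt (fun t : ℝ => (A.card : ℝ) * (c * δ) ^ t) s :=
      (continuous_const.mul (Real.continuous_const_rpow hcδ.ne')).continuousAt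
    have hev : ∀ᶠ t in nhdsWithin s (Ioi s), 1 < (A.card : ℝ) * (c * δ) ^ t :=
      nhdsWithin_le_nhds (hcont.tendsto.eventually (lt_mem_nhds hcon))
    obtain ⟨t, ht1, hts⟩ := (hev.and self_mem_nhdsWithin).exists
    have hts' : s < t := hts
    choose! h ρ h1 h2 h3 h4 using fun x hx => hcyl x hx δ hδ hδ1
    have : Nontrivial A := by
      rw [← Fintype.one_lt_card_iff_nontrivial]; simpa using hcard
    refine aux_L (ι := A) E hE hEc (fun a => h a) (fun a => ρ a)
      (fun a => hcδ.trans_le (h1 a (hA a a.2))) (fun a => h2 a (hA a a.2))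
      (fun a => h3 a (hA a a.2)) δ hδ ?_ t (hs.trans hts') ?_ (hz t hts')
    · intro j k hjk x hx y hy
      have g1 := h4 j (hA j j.2) x hx
      have g2 := h4 k (hA k k.2) y hy
      have g3 := hsep j j.2 k k.2 (fun hh => hjk (Subtype.ext hh))
      have g4 : |(j:ℝ) - k| ≤ |h j x - j| + |h j x - h k y| + |h k y - k| := by
        have e : (j:ℝ) - k = -(h j x - j) + (h j x - h k y) + (h k y - k) := by ring
        rw [e]
        refine (abs_add_le _ _).trans ?_
        refine add_le_add_left ((abs_add_le _ _).trans ?_) _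
        rw [abs_neg]
      linarith
    · calc (1:ℝ) ≤ (A.card : ℝ) * (c * δ) ^ t := ht1.le
        _ = ∑ _j : A, (c * δ) ^ t := by simp
        _ ≤ _ := Finset.sum_le_sum fun j _ =>
          Real.rpow_le_rpow hcδ.le (h1 j (hA j j.2)) (hs.trans hts').le
  refine (aux_H E s ((6 / c) ^ s) hs.le fun η hη => ?_).trans_lt ENNReal.ofReal_lt_top
  set δ := min (η / 6) 1
  have hδ : 0 < δ := lt_min (by positivity) one_pos
  have hδ1 : δ ≤ 1 := min_le_right _ _
  have hδη : 6 * δ ≤ η := by have : δ ≤ η / 6 := min_le_left _ _; linarith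
  have hcδ : 0 < c * δ := mul_pos hc hδ
  have hpp := Real.rpow_pos_of_pos hcδ s
  let P : ℕ → Prop := fun n => ∃ A : Finset ℝ, (∀ x ∈ A, x ∈ E) ∧
      (∀ x ∈ A, ∀ y ∈ A, x ≠ y → 3 * δ ≤ |x - y|) ∧ A.card = n
  have hP0 : P 0 := ⟨∅, by simp, by simp, by simp⟩
  obtain ⟨N, hN⟩ := exists_nat_ge (1 / (c * δ) ^ s)
  have hPN : ∀ n, P n → n ≤ N := by
    rintro n ⟨A, h1, h2, rfl⟩
    have := claim δ hδ hδ1 A h1 h2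
    rw [← le_div_iff₀ hpp] at this
    exact_mod_cast this.trans hN
  obtain ⟨A, hA1, hA2, hA3⟩ : P (Nat.findGreatest P N) :=
    Nat.findGreatest_spec (Nat.zero_le N) hP0
  have hmax : ∀ n, P n → n ≤ A.card := by
    intro n hn
    rw [hA3]
    exact Nat.le_findGreatest (hPN n hn) hn
  refine ⟨A, inferInstance, fun a => Metric.closedBall (a:ℝ) (3 * δ), fun _ => 6 * δ,
    fun _ => ⟨by positivity, hδη⟩, ?_, ?_, ?_⟩
  · intro a x hx y hy
    rw [Metric.mem_closedBall] at hx hy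
    rw [← Real.dist_eq]
    linarith [dist_triangle_right x y (a:ℝ)]
  · intro x hx
    by_contra hcon
    simp only [mem_iUnion, Metric.mem_closedBall, not_exists, not_le, Real.dist_eq] at hcon
    have hxA : x ∉ A := fun h => by
      have := hcon ⟨x, h⟩
      simp at this; linarith
    have := hmax (A.card + 1) ⟨insert x A, ?_, ?_, Finset.card_insert_of_notMem hxA⟩
    · omega
    · intro y hy
      rcases Finset.mem_insert.1 hy with rfl | hy
      · exact hx
      · exact hA1 y hy
    · intro y hy z hz hyz
      rcases Finset.mem_insert.1 hy with hy | hy <;> rcases Finset.mem_insert.1 hz with hz | hz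
      · exact absurd (hy.trans hz.symm) hyz
      · rw [hy]; exact (hcon ⟨z, hz⟩).le
      · rw [hz, abs_sub_comm]; exact (hcon ⟨y, hy⟩).le
      · exact hA2 y hy z hz hyz
  · have := claim δ hδ hδ1 A hA1 hA2
    have e1 : 6 * δ = (6 / c) * (c * δ) := by field_simp
    have h6c : 0 < 6 / c := by positivity
    beta_reduce
    rw [e1, Real.mul_rpow h6c.le hcδ.le]
    simp only [Finset.sum_const, Finset.card_univ, Fintype.card_coe, nsmul_eq_mul]
    calc (A.card : ℝ) * ((6 / c) ^ s * (c * δ) ^ s) = (6 / c) ^ s * (A.card * (c * δ) ^ s) := by ring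
      _ ≤ (6 / c) ^ s * 1 := mul_le_mul_of_nonneg_left this (Real.rpow_nonneg h6c.le _)
      _ = _ := mul_one _

namespace ClassE

def W (S : ClassE) : List ℕ → ℝ → ℝ
  | [] => id
  | i :: l => S.f i ∘ S.W l

def R (S : ClassE) : List ℕ → ℝ
  | [] => 1
  | i :: l => S.r i * S.R l

def okd (S : ClassE) (i : ℕ) : Prop := 1 ≤ i ∧ i ≤ S.m

def ok (S : ClassE) (l : List ℕ) : Prop := ∀ i ∈ l, S.okd i

variable (S : ClassE)

theorem f_sub (i : ℕ) (x y : ℝ) : S.f i x - S.f i y = S.r i * (x - y) := by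
  simp only [f]; ring

theorem W_sub (l : List ℕ) (x y : ℝ) : S.W l x - S.W l y = S.R l * (x - y) := by
  induction l with
  | nil => simp [W, R]
  | cons i l ih => simp only [W, R, Function.comp]; rw [f_sub, ih]; ring

theorem W_append (l l' : List ℕ) (x : ℝ) : S.W (l ++ l') x = S.W l (S.W l' x) := by
  induction l with
  | nil => simp [W]
  | cons i l ih => simp only [List.cons_append, W, Function.comp]; rw [ih]

theorem R_append (l l' : List ℕ) : S.R (l ++ l') = S.R l * S.R l' := by
  induction l with
  | nil => simp [R]
  | cons i l ih => simp only [List.cons_append, R]; rw [ih]; ring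

theorem r_pos {i : ℕ} (h : S.okd i) : 0 < S.r i := (S.hr i h.1 h.2).1

theorem r_lt {i : ℕ} (h : S.okd i) : S.r i < 1 := (S.hr i h.1 h.2).2

theorem ok_cons {i : ℕ} {l : List ℕ} : S.ok (i :: l) ↔ S.okd i ∧ S.ok l := by
  simp [ok]

theorem ok_nil : S.ok [] := by simp [ok]

theorem ok_append {l l' : List ℕ} : S.ok (l ++ l') ↔ S.ok l ∧ S.ok l' := by
  simp only [ok, List.mem_append]
  constructor
  · intro h; exact ⟨fun i hi => h i (Or.inl hi), fun i hi => h i (Or.inr hi)⟩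
  · rintro ⟨h1, h2⟩ i (hi | hi)
    exacts [h1 i hi, h2 i hi]

theorem ok_rep {i : ℕ} (h : S.okd i) (n : ℕ) : S.ok (List.replicate n i) := by
  intro j hj; rw [List.eq_of_mem_replicate hj]; exact h

theorem R_pos {l : List ℕ} (h : S.ok l) : 0 < S.R l := by
  induction l with
  | nil => simp [R]
  | cons i l ih =>
    rw [ok_cons] at h
    exact mul_pos (S.r_pos h.1) (ih h.2)

theorem ok1 : S.okd 1 := ⟨le_rfl, by have := S.hm; omega⟩
theorem okm : S.okd S.m := ⟨by have := S.hm; omega, le_rfl⟩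

theorem f_mono {i : ℕ} (h : S.okd i) {x y : ℝ} : S.f i x ≤ S.f i y ↔ x ≤ y := by
  have := S.f_sub i y x
  have h2 := S.r_pos h
  constructor
  · intro h3
    by_contra hc
    push Not at hc
    nlinarith
  · intro h3
    nlinarith

theorem f_smono {i : ℕ} (h : S.okd i) {x y : ℝ} : S.f i x < S.f i y ↔ x < y := by
  rw [← not_le, ← not_le, S.f_mono h]

theorem W_mono {l : List ℕ} (h : S.ok l) {x y : ℝ} : S.W l x ≤ S.W l y ↔ x ≤ y := by
  induction l with
  | nil => simp [W]
  | cons i l ih =>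
    rw [ok_cons] at h
    simp only [W, Function.comp]; rw [S.f_mono h.1, ih h.2]

theorem W_smono {l : List ℕ} (h : S.ok l) {x y : ℝ} : S.W l x < S.W l y ↔ x < y := by
  rw [← not_le, ← not_le, S.W_mono h]

theorem W_cont (l : List ℕ) : Continuous (S.W l) := by
  induction l with
  | nil => exact continuous_id
  | cons i l ih =>
    have : Continuous (S.f i) := by unfold f; fun_prop
    exact this.comp ih

theorem W_surj {l : List ℕ} (h : S.ok l) (y : ℝ) : ∃ x, S.W l x = y := by
  have hp := S.R_pos h
  refine ⟨(y - S.W l 0) / S.R l, ?_⟩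
  have := S.W_sub l ((y - S.W l 0) / S.R l) 0
  rw [sub_zero, mul_div_cancel₀ _ hp.ne'] at this
  linarith

theorem a_mem : S.a ∈ S.E := S.hEcpt.sInf_mem S.hEne
theorem b_mem : S.b ∈ S.E := S.hEcpt.sSup_mem S.hEne
theorem a_le {x : ℝ} (h : x ∈ S.E) : S.a ≤ x := csInf_le S.hEcpt.bddBelow h
theorem le_b {x : ℝ} (h : x ∈ S.E) : x ≤ S.b := le_csSup S.hEcpt.bddAbove h

theorem f_mem {i : ℕ} (h : S.okd i) {x : ℝ} (hx : x ∈ S.E) : S.f i x ∈ S.E := by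
  rw [S.hEinv]
  simp only [mem_iUnion, Finset.mem_Icc]
  exact ⟨i, h, x, hx, rfl⟩

theorem cases_E {x : ℝ} (hx : x ∈ S.E) : ∃ i, S.okd i ∧ ∃ y ∈ S.E, S.f i y = x := by
  rw [S.hEinv] at hx
  simp only [mem_iUnion, Finset.mem_Icc] at hx
  obtain ⟨i, h, y, hy, rfl⟩ := hx
  exact ⟨i, h, y, hy, rfl⟩

theorem W_mem {l : List ℕ} (h : S.ok l) {x : ℝ} (hx : x ∈ S.E) : S.W l x ∈ S.E := by
  induction l with
  | nil => exact hx
  | cons i l ih =>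
    rw [ok_cons] at h
    exact S.f_mem h.1 (ih h.2)

theorem iter_eq (i n : ℕ) : (S.f i)^[n] = S.W (List.replicate n i) := by
  induction n with
  | zero => rfl
  | succ n ih => rw [Function.iterate_succ', ih]; rfl

theorem bounds : ∃ c q : ℝ, 0 < c ∧ c ≤ 1 ∧ 0 < q ∧ q < 1 ∧ ∀ i, S.okd i → c ≤ S.r i ∧ S.r i ≤ q := by
  have hne : (Finset.Icc 1 S.m).Nonempty := ⟨1, Finset.mem_Icc.2 S.ok1⟩
  obtain ⟨i, hi, hi2⟩ := Finset.exists_min_image (Finset.Icc 1 S.m) S.r hne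
  obtain ⟨j, hj, hj2⟩ := Finset.exists_max_image (Finset.Icc 1 S.m) S.r hne
  have hi' : S.okd i := Finset.mem_Icc.1 hi
  have hj' : S.okd j := Finset.mem_Icc.1 hj
  exact ⟨S.r i, S.r j, S.r_pos hi', (S.r_lt hi').le, S.r_pos hj', S.r_lt hj',
    fun k hk => ⟨hi2 k (Finset.mem_Icc.2 hk), hj2 k (Finset.mem_Icc.2 hk)⟩⟩

variable {S}


theorem ab (hS : S.goodE) : S.a < S.b := (S.f_smono S.okm).1 hS.1.2.2.1

theorem f1a (hS : S.goodE) : S.f 1 S.a = S.a := hS.1.1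
theorem fmb (hS : S.goodE) : S.f S.m S.b = S.b := hS.1.2.2.2

theorem rep1a (hS : S.goodE) (n : ℕ) : S.W (List.replicate n 1) S.a = S.a := by
  induction n with
  | zero => rfl
  | succ n ih => simp only [List.replicate_succ, W, Function.comp]; rw [ih, f1a hS]

theorem repmb (hS : S.goodE) (n : ℕ) : S.W (List.replicate n S.m) S.b = S.b := by
  induction n with
  | zero => rfl
  | succ n ih => simp only [List.replicate_succ, W, Function.comp]; rw [ih, fmb hS]

theorem ord (hS : S.goodE) {i j : ℕ} (hi : 1 ≤ i) (hij : i ≤ j) (hj : j ≤ S.m) :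
    S.f i S.a ≤ S.f j S.a := by
  induction j, hij using Nat.le_induction with
  | base => exact le_rfl
  | succ j hij ih => exact (ih (by omega)).trans (hS.1.2.1 j (by omega) (by omega)).le

theorem fI {i : ℕ} (h : S.okd i) (x : ℝ) : x ∈ S.f i '' S.I ↔ S.f i S.a ≤ x ∧ x ≤ S.f i S.b := by
  constructor
  · rintro ⟨y, hy, rfl⟩
    exact ⟨(S.f_mono h).2 hy.1, (S.f_mono h).2 hy.2⟩
  · rintro ⟨h1, h2⟩
    obtain ⟨y, hy⟩ := S.W_surj (l := [i]) (by rw [ok_cons]; exact ⟨h, S.ok_nil⟩) x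
    have hy' : S.f i y = x := hy
    subst hy'
    exact ⟨y, ⟨(S.f_mono h).1 h1, (S.f_mono h).1 h2⟩, rfl⟩

theorem WI {l : List ℕ} (h : S.ok l) (x : ℝ) : x ∈ S.W l '' S.I ↔ S.W l S.a ≤ x ∧ x ≤ S.W l S.b := by
  constructor
  · rintro ⟨y, hy, rfl⟩
    exact ⟨(S.W_mono h).2 hy.1, (S.W_mono h).2 hy.2⟩
  · rintro ⟨h1, h2⟩
    obtain ⟨y, hy⟩ := S.W_surj h x
    subst hy
    exact ⟨y, ⟨(S.W_mono h).1 h1, (S.W_mono h).1 h2⟩, rfl⟩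

theorem sepB (hS : S.goodE) {i j : ℕ} (hi : 1 ≤ i) (hij : i + 2 ≤ j) (hj : j ≤ S.m) :
    S.f i S.b < S.f j S.a := by
  refine lt_of_lt_of_le ?_ (ord hS (by omega) hij hj)
  by_contra hc
  push Not at hc
  have h0 := hS.2.1 i hi (by omega)
  have hoi : S.okd i := ⟨hi, by omega⟩
  have hoi2 : S.okd (i + 2) := ⟨by omega, by omega⟩
  have : S.f (i + 2) S.a ∈ S.f i '' S.I ∩ S.f (i + 2) '' S.I :=
    ⟨(fI hoi _).2 ⟨ord hS hi (by omega) (by omega), hc⟩,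
     (fI hoi2 _).2 ⟨le_rfl, (S.f_mono hoi2).2 (ab hS).le⟩⟩
  rw [h0] at this
  exact this

theorem W_eq_of (hS : S.goodE) {l l' : List ℕ} (h : S.ok l) (h' : S.ok l')
    (heq : S.W l '' S.I = S.W l' '' S.I) : S.W l = S.W l' := by
  have hab := ab hS
  have ha1 : S.W l S.a ∈ S.W l '' S.I := ⟨_, ⟨le_rfl, hab.le⟩, rfl⟩
  have ha2 : S.W l' S.a ∈ S.W l' '' S.I := ⟨_, ⟨le_rfl, hab.le⟩, rfl⟩
  have hb1 : S.W l S.b ∈ S.W l '' S.I := ⟨_, ⟨hab.le, le_rfl⟩, rfl⟩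
  have hb2 : S.W l' S.b ∈ S.W l' '' S.I := ⟨_, ⟨hab.le, le_rfl⟩, rfl⟩
  rw [heq, WI h'] at ha1 hb1
  rw [← heq, WI h] at ha2 hb2
  have ea : S.W l S.a = S.W l' S.a := le_antisymm ha2.1 ha1.1
  have eb : S.W l S.b = S.W l' S.b := le_antisymm hb1.2 hb2.2
  have e1 := S.W_sub l S.b S.a
  have e2 := S.W_sub l' S.b S.a
  have eR : S.R l = S.R l' := by
    have : S.R l * (S.b - S.a) = S.R l' * (S.b - S.a) := by rw [← e1, ← e2, ea, eb]
    exact mul_right_cancel₀ (sub_pos.2 hab).ne' this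
  funext x
  have e3 := S.W_sub l x S.a
  have e4 := S.W_sub l' x S.a
  rw [eR] at e3
  linarith

theorem overlapD (hS : S.goodE) {i : ℕ} (hi : 1 ≤ i) (hi2 : i + 1 ≤ S.m)
    (hov : S.f (i + 1) S.a ≤ S.f i S.b) : ∃ u v : ℕ,
      S.W (i :: List.replicate u S.m) = S.W ((i + 1) :: List.replicate v 1) ∧ 1 ≤ u ∧ 1 ≤ v := by
  have hoi : S.okd i := ⟨hi, by omega⟩
  have hoi2 : S.okd (i + 1) := ⟨by omega, by omega⟩
  obtain ⟨u, v, hu, hv, h1, h2⟩ := hS.2.2.2 i hi hi2 (by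
    rw [← nonempty_iff_ne_empty]
    exact ⟨S.f (i + 1) S.a, (fI hoi _).2 ⟨ord hS hi (by omega) (by omega), hov⟩,
      (fI hoi2 _).2 ⟨le_rfl, (S.f_mono hoi2).2 (ab hS).le⟩⟩)
  refine ⟨u, v, ?_, hu, hv⟩
  apply W_eq_of hS ((S.ok_cons).2 ⟨hoi, S.ok_rep S.okm u⟩) ((S.ok_cons).2 ⟨hoi2, S.ok_rep S.ok1 v⟩)
  rw [h1, iter_eq, iter_eq] at h2
  exact h2

theorem Wi_b (hS : S.goodE) (i u : ℕ) : S.W (i :: List.replicate u S.m) S.b = S.f i S.b := by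
  simp only [W, Function.comp]; rw [repmb hS]

theorem Wi_a (hS : S.goodE) (i v : ℕ) : S.W (i :: List.replicate v 1) S.a = S.f i S.a := by
  simp only [W, Function.comp]; rw [rep1a hS]

theorem pow_zero_le {z q D : ℝ} (hq0 : 0 ≤ q) (hq1 : q < 1)
    (h : ∀ n : ℕ, z ≤ q ^ n * D) : z ≤ 0 := by
  have := (tendsto_pow_atTop_nhds_zero_of_lt_one hq0 hq1).mul_const D
  rw [zero_mul] at this
  exact ge_of_tendsto this (Eventually.of_forall h)

theorem claim_m (hS : S.goodE) {x : ℝ} (hx : x ∈ S.E) (hxm : S.f S.m S.a ≤ x) :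
    x ∈ S.f S.m '' S.E := by
  have hm3 := S.hm
  set B : Set ℝ := {x | x ∈ S.E ∧ S.f S.m S.a ≤ x ∧ x ∉ S.f S.m '' S.E} with hB
  have inner : ∀ (u : ℕ) (y : ℝ), y ∈ S.E → S.W (List.replicate u S.m) S.a ≤ y →
      y ∈ S.W (List.replicate u S.m) '' S.E ∨
        ∃ y' ∈ B, y - S.W (List.replicate u S.m) S.a ≤ y' - S.f S.m S.a := by
    intro u
    induction u with
    | zero => intro y hy _; exact Or.inl ⟨y, hy, rfl⟩
    | succ u ih =>
      intro y hy hle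
      simp only [List.replicate_succ, W, Function.comp] at hle ⊢
      have hge : S.f S.m S.a ≤ S.f S.m (S.W (List.replicate u S.m) S.a) :=
        (S.f_mono S.okm).2 (S.a_le (S.W_mem (S.ok_rep S.okm u) S.a_mem))
      by_cases hyf : y ∈ S.f S.m '' S.E
      · obtain ⟨z, hz, rfl⟩ := hyf
        have hz2 := (S.f_mono S.okm).1 hle
        rcases ih z hz hz2 with ⟨w, hw, rfl⟩ | ⟨y', hy', h'⟩
        · exact Or.inl ⟨w, hw, rfl⟩
        · refine Or.inr ⟨y', hy', ?_⟩
          rw [f_sub]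
          have := S.r_lt S.okm
          have := S.r_pos S.okm
          nlinarith
      · exact Or.inr ⟨y, ⟨hy, hge.trans hle, hyf⟩, by linarith⟩
  obtain ⟨p, hp⟩ : ∃ p, p + 1 = S.m := ⟨S.m - 1, by omega⟩
  have hop : S.okd p := ⟨by omega, by omega⟩
  have step : ∀ x ∈ B, ∃ y' ∈ B, x - S.f S.m S.a ≤ S.r p * (y' - S.f S.m S.a) := by
    rintro x ⟨hxE, hxq, hxn⟩
    obtain ⟨i, hi, y, hy, rfl⟩ := S.cases_E hxE
    have him : i ≠ S.m := by rintro rfl; exact hxn ⟨y, hy, rfl⟩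
    have hip : i = p := by
      by_contra hne
      have h1 := sepB hS hi.1 (j := S.m) (by have := hi.2; omega) le_rfl
      have h2 := (S.f_mono hi).2 (S.le_b hy)
      linarith
    subst hip
    obtain ⟨u, v, huv, -, -⟩ := overlapD hS hi.1 hp.le
      (by rw [hp]; exact hxq.trans ((S.f_mono hi).2 (S.le_b hy)))
    rw [hp] at huv
    have hqa : S.f i (S.W (List.replicate u S.m) S.a) = S.f S.m S.a := by
      have := congrFun huv S.a
      rw [Wi_a hS] at this
      exact this
    have hle : S.W (List.replicate u S.m) S.a ≤ y := by
      rw [← hqa] at hxq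
      exact (S.f_mono hi).1 hxq
    rcases inner u y hy hle with ⟨z, hz, rfl⟩ | ⟨y', hy', h'⟩
    · exfalso
      apply hxn
      have : S.f i (S.W (List.replicate u S.m) z) = S.f S.m (S.W (List.replicate v 1) z) :=
        congrFun huv z
      rw [this]
      exact ⟨_, S.W_mem (S.ok_rep S.ok1 v) hz, rfl⟩
    · refine ⟨y', hy', ?_⟩
      rw [← hqa, f_sub, hqa]
      exact mul_le_mul_of_nonneg_left h' (S.r_pos hi).le
  by_contra hxn
  have all : ∀ (n : ℕ), ∀ x ∈ B, x - S.f S.m S.a ≤ S.r p ^ n * (S.b - S.a) := by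
    intro n
    induction n with
    | zero =>
      intro x hx
      have h1 := S.le_b hx.1
      have h2 := S.a_le (S.f_mem S.okm S.a_mem)
      simp; linarith
    | succ n ih =>
      intro x hx
      obtain ⟨y', hy', h'⟩ := step x hx
      calc _ ≤ _ := h'
        _ ≤ S.r p * (S.r p ^ n * (S.b - S.a)) :=
          mul_le_mul_of_nonneg_left (ih y' hy') (S.r_pos hop).le
        _ = _ := by ring
  have h0 := pow_zero_le (S.r_pos hop).le (S.r_lt hop) (fun n => all n x ⟨hx, hxm, hxn⟩)
  have : x = S.f S.m S.a := le_antisymm (by linarith) hxm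
  exact hxn ⟨S.a, S.a_mem, this.symm⟩

theorem claim_1 (hS : S.goodE) {x : ℝ} (hx : x ∈ S.E) (hxm : x ≤ S.f 1 S.b) :
    x ∈ S.f 1 '' S.E := by
  have hm3 := S.hm
  set B : Set ℝ := {x | x ∈ S.E ∧ x ≤ S.f 1 S.b ∧ x ∉ S.f 1 '' S.E} with hB
  have inner : ∀ (u : ℕ) (y : ℝ), y ∈ S.E → y ≤ S.W (List.replicate u 1) S.b →
      y ∈ S.W (List.replicate u 1) '' S.E ∨
        ∃ y' ∈ B, S.W (List.replicate u 1) S.b - y ≤ S.f 1 S.b - y' := by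
    intro u
    induction u with
    | zero => intro y hy _; exact Or.inl ⟨y, hy, rfl⟩
    | succ u ih =>
      intro y hy hle
      simp only [List.replicate_succ, W, Function.comp] at hle ⊢
      have hge : S.f 1 (S.W (List.replicate u 1) S.b) ≤ S.f 1 S.b :=
        (S.f_mono S.ok1).2 (S.le_b (S.W_mem (S.ok_rep S.ok1 u) S.b_mem))
      by_cases hyf : y ∈ S.f 1 '' S.E
      · obtain ⟨z, hz, rfl⟩ := hyf
        have hz2 := (S.f_mono S.ok1).1 hle
        rcases ih z hz hz2 with ⟨w, hw, rfl⟩ | ⟨y', hy', h'⟩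
        · exact Or.inl ⟨w, hw, rfl⟩
        · refine Or.inr ⟨y', hy', ?_⟩
          rw [f_sub]
          have := S.r_lt S.ok1
          have := S.r_pos S.ok1
          nlinarith
      · exact Or.inr ⟨y, ⟨hy, hle.trans hge, hyf⟩, by linarith⟩
  have hop : S.okd 2 := ⟨by omega, by omega⟩
  have step : ∀ x ∈ B, ∃ y' ∈ B, S.f 1 S.b - x ≤ S.r 2 * (S.f 1 S.b - y') := by
    rintro x ⟨hxE, hxq, hxn⟩
    obtain ⟨i, hi, y, hy, rfl⟩ := S.cases_E hxE
    have him : i ≠ 1 := by rintro rfl; exact hxn ⟨y, hy, rfl⟩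
    have hip : i = 2 := by
      by_contra hne
      have h1 := sepB hS (i := 1) le_rfl (j := i) (by have := hi.1; omega) hi.2
      have h2 := (S.f_mono hi).2 (S.a_le hy)
      linarith
    subst hip
    obtain ⟨u, v, huv, -, -⟩ := overlapD hS (i := 1) le_rfl (by omega)
      (((S.f_mono hi).2 (S.a_le hy)).trans hxq)
    have hqa : S.f 2 (S.W (List.replicate v 1) S.b) = S.f 1 S.b := by
      have := congrFun huv S.b
      rw [Wi_b hS] at this
      exact this.symm
    have hle : y ≤ S.W (List.replicate v 1) S.b := by
      rw [← hqa] at hxq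
      exact (S.f_mono hi).1 hxq
    rcases inner v y hy hle with ⟨z, hz, rfl⟩ | ⟨y', hy', h'⟩
    · exfalso
      apply hxn
      have : S.f 1 (S.W (List.replicate u S.m) z) = S.f 2 (S.W (List.replicate v 1) z) :=
        congrFun huv z
      rw [← this]
      exact ⟨_, S.W_mem (S.ok_rep S.okm u) hz, rfl⟩
    · refine ⟨y', hy', ?_⟩
      rw [← hqa, f_sub, hqa]
      exact mul_le_mul_of_nonneg_left h' (S.r_pos hi).le
  by_contra hxn
  have all : ∀ (n : ℕ), ∀ x ∈ B, S.f 1 S.b - x ≤ S.r 2 ^ n * (S.b - S.a) := by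
    intro n
    induction n with
    | zero =>
      intro x hx
      have h1 := S.a_le hx.1
      have h2 := S.le_b (S.f_mem S.ok1 S.b_mem)
      simp; linarith
    | succ n ih =>
      intro x hx
      obtain ⟨y', hy', h'⟩ := step x hx
      calc _ ≤ _ := h'
        _ ≤ S.r 2 * (S.r 2 ^ n * (S.b - S.a)) :=
          mul_le_mul_of_nonneg_left (ih y' hy') (S.r_pos hop).le
        _ = _ := by ring
  have h0 := pow_zero_le (S.r_pos hop).le (S.r_lt hop) (fun n => all n x ⟨hx, hxm, hxn⟩)
  have : x = S.f 1 S.b := le_antisymm hxm (by linarith)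
  exact hxn ⟨S.b, S.b_mem, this.symm⟩

theorem claim_rep1 (hS : S.goodE) (v : ℕ) {y : ℝ} (hy : y ∈ S.E)
    (h : y ≤ S.W (List.replicate v 1) S.b) : y ∈ S.W (List.replicate v 1) '' S.E := by
  induction v generalizing y with
  | zero => exact ⟨y, hy, rfl⟩
  | succ v ih =>
    simp only [List.replicate_succ, W, Function.comp] at h ⊢
    obtain ⟨z, hz, rfl⟩ := claim_1 hS hy (h.trans
      ((S.f_mono S.ok1).2 (S.le_b (S.W_mem (S.ok_rep S.ok1 v) S.b_mem))))
    obtain ⟨w, hw, rfl⟩ := ih hz ((S.f_mono S.ok1).1 h)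
    exact ⟨w, hw, rfl⟩

theorem claim_repm (hS : S.goodE) (v : ℕ) {y : ℝ} (hy : y ∈ S.E)
    (h : S.W (List.replicate v S.m) S.a ≤ y) : y ∈ S.W (List.replicate v S.m) '' S.E := by
  induction v generalizing y with
  | zero => exact ⟨y, hy, rfl⟩
  | succ v ih =>
    simp only [List.replicate_succ, W, Function.comp] at h ⊢
    obtain ⟨z, hz, rfl⟩ := claim_m hS hy (le_trans
      ((S.f_mono S.okm).2 (S.a_le (S.W_mem (S.ok_rep S.okm v) S.a_mem))) h)
    obtain ⟨w, hw, rfl⟩ := ih hz ((S.f_mono S.okm).1 h)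
    exact ⟨w, hw, rfl⟩

theorem claim_i (hS : S.goodE) {i : ℕ} (hi : S.okd i) {x : ℝ} (hx : x ∈ S.E)
    (h1 : S.f i S.a ≤ x) (h2 : x ≤ S.f i S.b) : x ∈ S.f i '' S.E := by
  obtain ⟨j, hj, y, hy, rfl⟩ := S.cases_E hx
  have hya := (S.f_mono hj).2 (S.a_le hy)
  have hyb := (S.f_mono hj).2 (S.le_b hy)
  rcases lt_trichotomy j i with hlt | rfl | hlt
  · by_cases h3 : j + 2 ≤ i
    · have := sepB hS hj.1 h3 hi.2
      linarith
    · obtain rfl : i = j + 1 := by omega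
      obtain ⟨u, v, huv, -, -⟩ := overlapD hS hj.1 hi.2 (h1.trans hyb)
      have e := congrFun huv S.a
      rw [Wi_a hS] at e
      rw [← e] at h1
      obtain ⟨z, hz, rfl⟩ := claim_repm hS u hy ((S.f_mono hj).1 h1)
      have e2 : S.f j (S.W (List.replicate u S.m) z) = S.f (j + 1) (S.W (List.replicate v 1) z) :=
        congrFun huv z
      rw [e2]
      exact ⟨_, S.W_mem (S.ok_rep S.ok1 v) hz, rfl⟩
  · exact ⟨y, hy, rfl⟩
  · by_cases h3 : i + 2 ≤ j
    · have := sepB hS hi.1 h3 hj.2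
      linarith
    · obtain rfl : j = i + 1 := by omega
      obtain ⟨u, v, huv, -, -⟩ := overlapD hS hi.1 hj.2 (hya.trans h2)
      have e := congrFun huv S.b
      rw [Wi_b hS] at e
      rw [e] at h2
      obtain ⟨z, hz, rfl⟩ := claim_rep1 hS v hy ((S.f_mono hj).1 h2)
      have e2 : S.f i (S.W (List.replicate u S.m) z) = S.f (i + 1) (S.W (List.replicate v 1) z) :=
        congrFun huv z
      rw [← e2]
      exact ⟨_, S.W_mem (S.ok_rep S.okm u) hz, rfl⟩

theorem claim_W (hS : S.goodE) {l : List ℕ} (hl : S.ok l) {x : ℝ} (hx : x ∈ S.E)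
    (hxI : x ∈ S.W l '' S.I) : x ∈ S.W l '' S.E := by
  induction l generalizing x with
  | nil => exact ⟨x, hx, rfl⟩
  | cons i l ih =>
    rw [ok_cons] at hl
    obtain ⟨y, hy, rfl⟩ := hxI
    simp only [W, Function.comp] at hx ⊢
    have ha := S.W_mem hl.2 S.a_mem
    have hb := S.W_mem hl.2 S.b_mem
    have h1 : S.a ≤ S.W l y := (S.a_le ha).trans ((S.W_mono hl.2).2 hy.1)
    have h2 : S.W l y ≤ S.b := le_trans ((S.W_mono hl.2).2 hy.2) (S.le_b hb)
    obtain ⟨z, hz, hzz⟩ := claim_i hS hl.1 hx ((S.f_mono hl.1).2 h1) ((S.f_mono hl.1).2 h2)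
    have : z = S.W l y := le_antisymm ((S.f_mono hl.1).1 hzz.le) ((S.f_mono hl.1).1 hzz.ge)
    rw [this] at hz
    obtain ⟨w, hw, hww⟩ := ih hl.2 hz ⟨y, hy, rfl⟩
    exact ⟨w, hw, congrArg (S.f i) hww⟩

theorem fE_closed (i : ℕ) : IsClosed (S.f i '' S.E) :=
  (S.hEcpt.image (by unfold f; fun_prop)).isClosed

theorem local_i (hS : S.goodE) {x : ℝ} (hx : x ∈ S.E) :
    ∃ i, S.okd i ∧ ∀ᶠ y in nhds x, y ∈ S.E → y ∈ S.f i '' S.E := by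
  have hfar : ∀ᶠ y in nhds x, ∀ j ∈ Finset.Icc 1 S.m, x ∉ S.f j '' S.E → y ∉ S.f j '' S.E := by
    rw [Filter.eventually_all_finset]
    intro j _
    by_cases h : x ∈ S.f j '' S.E
    · simp [h]
    · have := (fE_closed (S := S) j).isOpen_compl.mem_nhds h
      filter_upwards [this] with y hy _ using hy
  have hfar' : ∀ᶠ y in nhds x, y ∈ S.E → ∃ j, S.okd j ∧ x ∈ S.f j '' S.E ∧ y ∈ S.f j '' S.E := by
    filter_upwards [hfar] with y hy hyE
    obtain ⟨j, hj, z, hz, rfl⟩ := S.cases_E hyE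
    refine ⟨j, hj, ?_, ⟨z, hz, rfl⟩⟩
    by_contra hc
    exact hy j (Finset.mem_Icc.2 hj) hc ⟨z, hz, rfl⟩
  by_cases huniq : ∃ i, 1 ≤ i ∧ i + 1 ≤ S.m ∧ x ∈ S.f i '' S.E ∧ x ∈ S.f (i + 1) '' S.E
  · obtain ⟨i, hi1, hi2, ⟨y, hy, rfl⟩, ⟨z, hz, hzz⟩⟩ := huniq
    have hi : S.okd i := ⟨hi1, by omega⟩
    have hi' : S.okd (i + 1) := ⟨by omega, by omega⟩
    have A1 : S.f (i + 1) S.a ≤ S.f i y := by rw [← hzz]; exact (S.f_mono hi').2 (S.a_le hz)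
    have A2 : S.f i y ≤ S.f i S.b := (S.f_mono hi).2 (S.le_b hy)
    have only : ∀ j, S.okd j → S.f i y ∈ S.f j '' S.E → j = i ∨ j = i + 1 := by
      rintro j hj ⟨w, hw, hww⟩
      have g1 := (S.f_mono hj).2 (S.a_le hw)
      have g2 := (S.f_mono hj).2 (S.le_b hw)
      by_contra hc
      rcases (by omega : j + 2 ≤ i + 1 ∨ i + 2 ≤ j) with h | h
      · have := sepB hS hj.1 h hi'.2
        linarith
      · have := sepB hS hi.1 h hj.2
        linarith
    obtain ⟨u, v, huv, hu, hv⟩ := overlapD hS hi1 hi2 (A1.trans A2)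
    have ea := congrFun huv S.a
    have eb := congrFun huv S.b
    rw [Wi_a hS] at ea
    rw [Wi_b hS] at eb
    have hbb : S.f i S.b ≤ S.f (i + 1) S.b := by
      rw [eb]
      exact (S.f_mono hi').2 (S.le_b (S.W_mem (S.ok_rep S.ok1 v) S.b_mem))
    have haa : S.f i S.a ≤ S.f (i + 1) S.a := ord hS hi1 (by omega) hi2
    have hlt : S.f (i + 1) S.a < S.f i S.b := by
      rw [← ea, ← Wi_b hS i u]
      exact (S.W_smono (S.ok_cons.2 ⟨hi, S.ok_rep S.okm u⟩)).2 (ab hS)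
    rcases A1.lt_or_eq with h | h
    · refine ⟨i + 1, hi', ?_⟩
      filter_upwards [hfar', lt_mem_nhds h] with w hw hw2 hwE
      obtain ⟨j, hj, hxj, hwj⟩ := hw hwE
      rcases only j hj hxj with rfl | rfl
      · obtain ⟨p, hp, rfl⟩ := hwj
        exact claim_i hS hi' hwE hw2.le (((S.f_mono hi).2 (S.le_b hp)).trans hbb)
      · exact hwj
    · refine ⟨i, hi, ?_⟩
      rw [h] at hlt
      filter_upwards [hfar', gt_mem_nhds hlt] with w hw hw2 hwE
      obtain ⟨j, hj, hxj, hwj⟩ := hw hwE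
      rcases only j hj hxj with rfl | rfl
      · exact hwj
      · obtain ⟨p, hp, rfl⟩ := hwj
        exact claim_i hS hi hwE (haa.trans ((S.f_mono hi').2 (S.a_le hp))) hw2.le
  · push Not at huniq
    obtain ⟨i, hi, y, hy, hyx⟩ := S.cases_E hx
    refine ⟨i, hi, ?_⟩
    filter_upwards [hfar'] with w hw hwE
    obtain ⟨j, hj, hxj, hwj⟩ := hw hwE
    have : j = i := by
      have hxi : x ∈ S.f i '' S.E := ⟨y, hy, hyx⟩
      obtain ⟨p, hp, hpx⟩ := hxj
      have g1 := (S.f_mono hj).2 (S.a_le hp)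
      have g2 := (S.f_mono hj).2 (S.le_b hp)
      have g3 := (S.f_mono hi).2 (S.a_le hy)
      have g4 := (S.f_mono hi).2 (S.le_b hy)
      by_contra hne
      rcases (by omega : j = i + 1 ∨ i = j + 1 ∨ j + 2 ≤ i ∨ i + 2 ≤ j) with h | h | h | h
      · subst h
        exact huniq i hi.1 hj.2 hxi ⟨p, hp, hpx⟩
      · subst h
        exact huniq j hj.1 hi.2 ⟨p, hp, hpx⟩ hxi
      · have := sepB hS hj.1 h hi.2
        linarith
      · have := sepB hS hi.1 h hj.2
        linarith
    rw [← this]; exact hwj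

theorem leb (hS : S.goodE) : ∃ δ : ℝ, 0 < δ ∧ ∀ x ∈ S.E, ∃ i, S.okd i ∧
    ∀ y ∈ S.E, |y - x| < δ → y ∈ S.f i '' S.E := by
  obtain ⟨δ, hδ, h⟩ := lebesgue_number_lemma_of_metric (s := S.E)
    (c := fun i : {i // S.okd i} => interior {y | y ∈ S.E → y ∈ S.f i '' S.E}) S.hEcpt
    (fun i => isOpen_interior) (by
      intro x hx
      obtain ⟨i, hi, h⟩ := local_i hS hx
      exact mem_iUnion.2 ⟨⟨i, hi⟩, mem_interior_iff_mem_nhds.2 h⟩)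
  refine ⟨δ, hδ, fun x hx => ?_⟩
  obtain ⟨⟨i, hi⟩, hb⟩ := h x hx
  refine ⟨i, hi, fun y hy hyx => ?_⟩
  exact interior_subset (hb (by rw [Metric.mem_ball, Real.dist_eq]; exact hyx)) hy

theorem expand (hS : S.goodE) : ∃ δ : ℝ, 0 < δ ∧ ∀ F ⊆ S.E,
    (∀ i, S.okd i → ∀ y ∈ S.E, S.f i y ∈ F → y ∈ F) →
    ∀ U ⊆ F, ∀ ε : ℝ, 0 < ε → (∀ x ∈ U, ∀ y ∈ U, |x - y| ≤ ε) →
      ∃ l, S.ok l ∧ U ⊆ S.W l '' F ∧ S.R l ≤ ε / δ := by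
  obtain ⟨δ, hδ, hleb⟩ := leb hS
  obtain ⟨c, q, hc, hc1, hq, hq1, hr⟩ := S.bounds
  refine ⟨δ, hδ, fun F hFE hF => ?_⟩
  have main : ∀ (n : ℕ), ∀ U ⊆ F, ∀ ε : ℝ, δ * q ^ n ≤ ε → (∀ x ∈ U, ∀ y ∈ U, |x - y| ≤ ε) →
      ∃ l, S.ok l ∧ U ⊆ S.W l '' F ∧ S.R l ≤ ε / δ := by
    intro n
    induction n with
    | zero =>
      intro U hU ε hε _
      refine ⟨[], S.ok_nil, by simpa [W] using hU, ?_⟩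
      simp only [R]
      rw [le_div_iff₀ hδ]
      simpa using hε
    | succ n ih =>
      intro U hU ε hε hd
      by_cases hbig : δ ≤ ε
      · refine ⟨[], S.ok_nil, by simpa [W] using hU, ?_⟩
        simp only [R]
        rw [le_div_iff₀ hδ]
        simpa using hbig
      push Not at hbig
      obtain ⟨i, hi, hUi⟩ : ∃ i, S.okd i ∧ U ⊆ S.f i '' S.E := by
        rcases U.eq_empty_or_nonempty with rfl | ⟨x, hx⟩
        · exact ⟨1, S.ok1, empty_subset _⟩
        · obtain ⟨i, hi, h⟩ := hleb x (hFE (hU hx))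
          exact ⟨i, hi, fun y hy => h y (hFE (hU hy)) ((hd y hy x hx).trans_lt hbig)⟩
      have hri := S.r_pos hi
      obtain ⟨l, hl, hl2, hl3⟩ := ih {y | y ∈ S.E ∧ S.f i y ∈ U}
        (fun y hy => hF i hi y hy.1 (hU hy.2)) (ε / S.r i)
        (by
          rw [le_div_iff₀ hri]
          calc δ * q ^ n * S.r i ≤ δ * q ^ n * q :=
                mul_le_mul_of_nonneg_left (hr i hi).2 (by positivity)
            _ = δ * q ^ (n + 1) := by ring
            _ ≤ ε := hε)
        (by
          intro x hx y hy
          rw [le_div_iff₀ hri]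
          have := hd _ hx.2 _ hy.2
          rw [f_sub, abs_mul, abs_of_pos hri] at this
          linarith)
      refine ⟨i :: l, S.ok_cons.2 ⟨hi, hl⟩, ?_, ?_⟩
      · intro x hx
        obtain ⟨y, hy, rfl⟩ := hUi hx
        obtain ⟨z, hz, rfl⟩ := hl2 ⟨hy, hx⟩
        exact ⟨z, hz, rfl⟩
      · simp only [R]
        calc S.r i * S.R l ≤ S.r i * (ε / S.r i / δ) := mul_le_mul_of_nonneg_left hl3 hri.le
          _ = ε / δ := by field_simp
  intro U hU ε hε hd
  obtain ⟨n, hn⟩ := exists_pow_lt_of_lt_one (div_pos hε hδ) hq1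
  refine main n U hU ε ?_ hd
  rw [lt_div_iff₀ hδ] at hn
  linarith

theorem cyl (S : ClassE) : ∃ c : ℝ, 0 < c ∧ c ≤ 1 ∧ ∀ x ∈ S.E, ∀ δ : ℝ, 0 < δ → δ ≤ 1 →
    ∃ l, S.ok l ∧ x ∈ S.W l '' S.E ∧ c * δ ≤ S.R l ∧ S.R l ≤ δ := by
  obtain ⟨c, q, hc, hc1, hq, hq1, hr⟩ := S.bounds
  refine ⟨c, hc, hc1, ?_⟩
  have main : ∀ (n : ℕ), ∀ x ∈ S.E, ∀ δ : ℝ, q ^ n ≤ δ → δ ≤ 1 →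
      ∃ l, S.ok l ∧ x ∈ S.W l '' S.E ∧ c * δ ≤ S.R l ∧ S.R l ≤ δ := by
    intro n
    induction n with
    | zero =>
      intro x hx δ h1 h2
      have : δ = 1 := le_antisymm h2 (by simpa using h1)
      subst this
      exact ⟨[], S.ok_nil, ⟨x, hx, rfl⟩, by simpa [R] using hc1, by simp [R]⟩
    | succ n ih =>
      intro x hx δ h1 h2
      obtain ⟨i, hi, y, hy, rfl⟩ := S.cases_E hx
      have hri := S.r_pos hi
      by_cases h : S.r i ≤ δ
      · refine ⟨[i], S.ok_cons.2 ⟨hi, S.ok_nil⟩, ⟨y, hy, rfl⟩, ?_, by simpa [R] using h⟩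
        simp only [R, mul_one]
        refine le_trans ?_ (hr i hi).1
        exact mul_le_of_le_one_right hc.le h2
      · push Not at h
        obtain ⟨l, hl, ⟨z, hz, rfl⟩, h3, h4⟩ := ih y hy (δ / S.r i)
          (by
            rw [le_div_iff₀ hri]
            calc q ^ n * S.r i ≤ q ^ n * q := mul_le_mul_of_nonneg_left (hr i hi).2 (by positivity)
              _ ≤ δ := h1)
          (by rw [div_le_one hri]; exact h.le)
        refine ⟨i :: l, S.ok_cons.2 ⟨hi, hl⟩, ⟨z, hz, rfl⟩, ?_, ?_⟩
        · simp only [R]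
          calc c * δ = S.r i * (c * (δ / S.r i)) := by field_simp
            _ ≤ _ := mul_le_mul_of_nonneg_left h3 hri.le
        · simp only [R]
          calc S.r i * S.R l ≤ S.r i * (δ / S.r i) := mul_le_mul_of_nonneg_left h4 hri.le
            _ = δ := by field_simp
  intro x hx δ hδ hδ1
  obtain ⟨n, hn⟩ := exists_pow_lt_of_lt_one hδ hq1
  exact main n x hx δ hn.le hδ1

def consSeq (i : ℕ) (d : ℕ → ℕ) : ℕ → ℕ
  | 0 => i
  | n + 1 => d n

theorem prefix_cons (i : ℕ) (d : ℕ → ℕ) (n : ℕ) (x : ℝ) :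
    S.prefixMap (consSeq i d) (n + 1) x = S.f i (S.prefixMap d n x) := by
  induction n generalizing x with
  | zero => rfl
  | succ n ih =>
    change S.prefixMap (consSeq i d) (n + 1) (S.f (d n) x) = S.f i (S.prefixMap d n (S.f (d n) x))
    exact ih _

theorem coding_cons {i : ℕ} (hi : S.okd i) {d : ℕ → ℕ} {x : ℝ} (h : S.isCoding d x) :
    S.isCoding (consSeq i d) (S.f i x) := by
  refine ⟨?_, ?_⟩
  · intro n
    cases n with
    | zero => exact hi
    | succ n => exact h.1 n
  · rw [← tendsto_add_atTop_iff_nat 1]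
    simp only [prefix_cons]
    have hc : Continuous (S.f i) := by unfold f; fun_prop
    exact (hc.tendsto x).comp h.2

theorem coding_exists (S : ClassE) {x : ℝ} (hx : x ∈ S.E) : ∃ d, S.isCoding d x := by
  obtain ⟨c, q, hc, hc1, hq, hq1, hr⟩ := S.bounds
  choose! g hg nx hnx hfx using fun x (hx : x ∈ S.E) => S.cases_E hx
  let y : ℕ → ℝ := fun n => nx^[n] x
  have hy : ∀ n, y n ∈ S.E := by
    intro n
    induction n with
    | zero => exact hx
    | succ n ih => simp only [y, Function.iterate_succ_apply']; exact hnx _ ih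
  have hys : ∀ n, S.f (g (y n)) (y (n + 1)) = y n := by
    intro n
    have : y (n + 1) = nx (y n) := by simp only [y, Function.iterate_succ_apply']
    rw [this]; exact hfx _ (hy n)
  let d : ℕ → ℕ := fun n => g (y n)
  have hd : ∀ n, S.okd (d n) := fun n => hg _ (hy n)
  have h1 : ∀ n, S.prefixMap d n (y n) = x := by
    intro n
    induction n with
    | zero => rfl
    | succ n ih =>
      change S.prefixMap d n (S.f (g (y n)) (y (n + 1))) = x
      rw [hys, ih]
  have h2 : ∀ n u v, |S.prefixMap d n u - S.prefixMap d n v| ≤ q ^ n * |u - v| := by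
    intro n
    induction n with
    | zero => intro u v; simp [prefixMap]
    | succ n ih =>
      intro u v
      change |S.prefixMap d n (S.f (d n) u) - S.prefixMap d n (S.f (d n) v)| ≤ _
      refine (ih _ _).trans ?_
      rw [f_sub, abs_mul, abs_of_pos (S.r_pos (hd n))]
      calc q ^ n * (S.r (d n) * |u - v|) ≤ q ^ n * (q * |u - v|) := by
            have := (hr _ (hd n)).2
            gcongr
        _ = _ := by ring
  obtain ⟨M, hM⟩ := S.hEcpt.isBounded.exists_norm_le
  refine ⟨d, hd, ?_⟩
  rw [tendsto_iff_dist_tendsto_zero]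
  have hlim : Tendsto (fun n : ℕ => q ^ n * M) atTop (nhds 0) := by
    simpa using (tendsto_pow_atTop_nhds_zero_of_lt_one hq.le hq1).mul_const M
  refine squeeze_zero (fun n => dist_nonneg) (fun n => ?_) hlim
  rw [Real.dist_eq]
  calc |S.prefixMap d n 0 - x| = |S.prefixMap d n 0 - S.prefixMap d n (y n)| := by rw [h1]
    _ ≤ q ^ n * |0 - y n| := h2 n _ _
    _ ≤ q ^ n * M := by
      have := hM _ (hy n)
      rw [zero_sub, abs_neg]
      exact mul_le_mul_of_nonneg_left this (by positivity)

theorem coding_two {l : List ℕ} (hl : S.ok l) {x : ℝ}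
    (h : ∃ d d', d ≠ d' ∧ S.isCoding d x ∧ S.isCoding d' x) :
    ∃ d d', d ≠ d' ∧ S.isCoding d (S.W l x) ∧ S.isCoding d' (S.W l x) := by
  induction l with
  | nil => exact h
  | cons i l ih =>
    rw [ok_cons] at hl
    obtain ⟨d, d', hne, h1, h2⟩ := ih hl.2
    refine ⟨consSeq i d, consSeq i d', ?_, coding_cons hl.1 h1, coding_cons hl.1 h2⟩
    intro he
    exact hne (funext fun n => congrFun he (n + 1))

theorem two_of_overlap {i j : ℕ} {l l' : List ℕ} (hij : i ≠ j) (h : S.ok (i :: l))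
    (h' : S.ok (j :: l')) {z : ℝ} (hz : z ∈ S.E) (he : S.W (i :: l) z = S.W (j :: l') z) :
    ∃ d d', d ≠ d' ∧ S.isCoding d (S.W (i :: l) z) ∧ S.isCoding d' (S.W (i :: l) z) := by
  rw [ok_cons] at h h'
  obtain ⟨d, hd⟩ := S.coding_exists (S.W_mem h.2 hz)
  obtain ⟨d', hd'⟩ := S.coding_exists (S.W_mem h'.2 hz)
  refine ⟨consSeq i d, consSeq j d', fun e => hij (congrFun e 0), coding_cons h.1 hd, ?_⟩
  rw [he]
  exact coding_cons h'.1 hd'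

theorem W_abs {l : List ℕ} (hl : S.ok l) (x y : ℝ) : |S.W l x - S.W l y| = S.R l * |x - y| := by
  rw [W_sub, abs_mul, abs_of_pos (S.R_pos hl)]

theorem haus_upper {l : List ℕ} (hl : S.ok l) (s : ℝ) (hs : 0 ≤ s) (A : Set ℝ) :
    μH[s] (S.W l '' A) ≤ ENNReal.ofReal (S.R l ^ s) * μH[s] A := by
  have hL : LipschitzWith (Real.toNNReal (S.R l)) (S.W l) := by
    apply LipschitzWith.of_dist_le_mul
    intro x y
    rw [Real.dist_eq, Real.dist_eq, W_abs hl, Real.coe_toNNReal _ (S.R_pos hl).le]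
  have := hL.hausdorffMeasure_image_le hs A
  rw [← ENNReal.ofReal_rpow_of_nonneg (S.R_pos hl).le hs]
  exact this

theorem haus_lower {l : List ℕ} (hl : S.ok l) (s : ℝ) (hs : 0 ≤ s) (A : Set ℝ) :
    ENNReal.ofReal (S.R l ^ s) * μH[s] A ≤ μH[s] (S.W l '' A) := by
  have hp := S.R_pos hl
  have hL : AntilipschitzWith (Real.toNNReal (S.R l)⁻¹) (S.W l) := by
    apply AntilipschitzWith.of_le_mul_dist
    intro x y
    rw [Real.dist_eq, Real.dist_eq, W_abs hl, Real.coe_toNNReal _ (inv_pos.2 hp).le,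
      inv_mul_cancel_left₀ hp.ne']
  have := hL.le_hausdorffMeasure_image hs A
  have e : ((Real.toNNReal (S.R l)⁻¹ : NNReal) : ENNReal) ^ s = ENNReal.ofReal ((S.R l)⁻¹ ^ s) :=
    ENNReal.ofReal_rpow_of_nonneg (inv_pos.2 hp).le hs
  rw [e] at this
  calc _ ≤ ENNReal.ofReal (S.R l ^ s) * (ENNReal.ofReal ((S.R l)⁻¹ ^ s) * μH[s] (S.W l '' A)) := by
        gcongr
    _ = _ := by
      rw [← mul_assoc, ← ENNReal.ofReal_mul (Real.rpow_nonneg hp.le _),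
        ← Real.mul_rpow hp.le (inv_pos.2 hp).le, mul_inv_cancel₀ hp.ne']
      simp

theorem dim_pos (hS : S.goodE) : 0 < dimH S.E := by
  have hm := S.hm
  have h1 := S.r_pos S.ok1
  have h2 := S.r_pos S.okm
  have hcont : ContinuousAt (fun t : ℝ => S.r 1 ^ t + S.r S.m ^ t) 0 :=
    ((Real.continuous_const_rpow h1.ne').add (Real.continuous_const_rpow h2.ne')).continuousAt
  have hev : ∀ᶠ t in nhdsWithin (0:ℝ) (Ioi 0), 1 < S.r 1 ^ t + S.r S.m ^ t :=
    nhdsWithin_le_nhds (hcont.tendsto.eventually (lt_mem_nhds (by norm_num)))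
  obtain ⟨t, ht1, ht0⟩ := (hev.and self_mem_nhdsWithin).exists
  have ht0' : 0 < t := ht0
  have hsep := sepB hS (i := 1) le_rfl (j := S.m) (by omega) le_rfl
  have key : ∀ x ∈ S.E, ∀ y ∈ S.E, S.f S.m S.a - S.f 1 S.b ≤ S.f S.m y - S.f 1 x := by
    intro x hx y hy
    have := (S.f_mono S.ok1).2 (S.le_b hx)
    have := (S.f_mono S.okm).2 (S.a_le hy)
    linarith
  have hne := aux_L (ι := Bool) S.E S.hEne S.hEcpt (fun b => if b then S.f 1 else S.f S.m)
    (fun b => if b then S.r 1 else S.r S.m) (by intro b; cases b <;> simp [h1, h2])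
    (by
      intro b x y
      cases b
      · simp only [Bool.false_eq_true, if_false]
        rw [f_sub, abs_mul, abs_of_pos h2]
      · simp only [if_true]
        rw [f_sub, abs_mul, abs_of_pos h1])
    (by
      intro b x hx
      cases b
      · simpa using S.f_mem S.okm hx
      · simpa using S.f_mem S.ok1 hx)
    (S.f S.m S.a - S.f 1 S.b) (by linarith)
    (by
      intro b b' hbb x hx y hy
      cases b <;> cases b' <;> simp at hbb ⊢
      · have := key y hy x hx
        linarith [le_abs_self (S.f S.m x - S.f 1 y), le_abs_self (S.f S.m y - S.f 1 x)]
      · have := key x hx y hy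
        rw [abs_sub_comm]
        linarith [le_abs_self (S.f S.m x - S.f 1 y), le_abs_self (S.f S.m y - S.f 1 x)])
    t ht0' (by simpa [add_comm] using ht1.le)
  have : ((Real.toNNReal t : NNReal) : ENNReal) ≤ dimH S.E := by
    apply le_dimH_of_hausdorffMeasure_ne_zero
    rw [Real.coe_toNNReal _ ht0'.le]
    exact hne
  refine lt_of_lt_of_le ?_ this
  simpa using ht0'

theorem cylB (S : ClassE) : ∃ c : ℝ, 0 < c ∧ c ≤ 1 ∧ ∀ x ∈ S.E, ∀ δ : ℝ, 0 < δ → δ ≤ 1 →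
    ∃ l, S.ok l ∧ c * δ ≤ S.R l ∧ ∀ y ∈ S.E, |S.W l y - x| ≤ δ := by
  obtain ⟨c, hc, hc1, hcyl⟩ := cyl S
  set D := max (S.b - S.a) 1
  have hD1 : 1 ≤ D := le_max_right _ _
  have hD : 0 < D := by linarith
  refine ⟨c / D, by positivity, (div_le_one hD).2 (hc1.trans hD1), fun x hx δ hδ hδ1 => ?_⟩
  obtain ⟨l, hl, ⟨z, hz, rfl⟩, h1, h2⟩ := hcyl x hx (δ / D) (by positivity)
    ((div_le_one hD).2 (hδ1.trans hD1))
  refine ⟨l, hl, ?_, ?_⟩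
  · calc c / D * δ = c * (δ / D) := by ring
      _ ≤ _ := h1
  · intro y hy
    rw [W_abs hl]
    have hyz : |y - z| ≤ D := by
      refine le_trans ?_ (le_max_left _ _)
      have := S.a_le hy
      have := S.le_b hy
      have := S.a_le hz
      have := S.le_b hz
      rw [abs_le]; constructor <;> linarith
    calc S.R l * |y - z| ≤ δ / D * D := mul_le_mul h2 hyz (abs_nonneg _) (by positivity)
      _ = δ := by field_simp

theorem null_F (hS : S.goodE) (s : ℝ) (hs : 0 < s) (h0 : μH[s] S.E ≠ 0) (hT : μH[s] S.E ≠ ⊤)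
    (F : Set ℝ) (hFE : F ⊆ S.E) (hFm : MeasurableSet F) (τ : List ℕ) (hτ : S.ok τ)
    (hF : ∀ l, S.ok l → Disjoint F (S.W (l ++ τ) '' S.E)) : μH[s] F = 0 := by
  obtain ⟨c, hc, hc1, hcyl⟩ := cylB S
  obtain ⟨δ0, hδ0, hexp⟩ := expand hS
  by_contra hne
  set μ : Measure ℝ := (μH[s]).restrict S.E with hμ
  have hEm : MeasurableSet S.E := S.hEcpt.isClosed.measurableSet
  have : IsFiniteMeasure μ := ⟨by rw [hμ, Measure.restrict_apply_univ]; exact lt_top_iff_ne_top.2 hT⟩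
  have hμF : μ F ≠ 0 := by
    rw [hμ, Measure.restrict_apply hFm, inter_eq_self_of_subset_left hFE]; exact hne
  have hd := Besicovitch.ae_tendsto_measure_inter_div μ F
  have hmem : ∀ᵐ x ∂(μ.restrict F), x ∈ F := ae_restrict_mem hFm
  have : NeZero (μ.restrict F) := ⟨by rwa [Ne, Measure.restrict_eq_zero]⟩
  obtain ⟨x, hx, hxF⟩ := (hd.and hmem).exists
  have hRτ := S.R_pos hτ
  set κ : ℝ := (c * S.R τ * (δ0 / 2)) ^ s with hκ
  have hκ0 : 0 < κ := Real.rpow_pos_of_pos (by positivity) s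
  have bound : ∀ δ : ℝ, 0 < δ → δ ≤ 1 →
      μ (F ∩ Metric.closedBall x δ) / μ (Metric.closedBall x δ) + ENNReal.ofReal κ ≤ 1 := by
    intro δ hδ hδ1
    set B := Metric.closedBall x δ with hB
    obtain ⟨l, hl, hl1, hl2⟩ := hcyl x (hFE hxF) δ hδ hδ1
    have hlτ : S.ok (l ++ τ) := S.ok_append.2 ⟨hl, hτ⟩
    set H := S.W (l ++ τ) '' S.E with hH
    have hHE : H ⊆ S.E := by rintro _ ⟨y, hy, rfl⟩; exact S.W_mem hlτ hy
    have hHB : H ⊆ B := by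
      rintro _ ⟨y, hy, rfl⟩
      rw [hB, Metric.mem_closedBall, Real.dist_eq, W_append]
      exact hl2 _ (S.W_mem hτ hy)
    have hHm : MeasurableSet H := (S.hEcpt.image (S.W_cont _)).isClosed.measurableSet
    -- upper bound of the ball
    obtain ⟨l', hl', hsub, hR'⟩ := hexp S.E subset_rfl (fun _ _ y hy _ => hy) (B ∩ S.E)
      inter_subset_right (2 * δ) (by positivity) (by
        intro u hu v hv
        have h1 := Metric.mem_closedBall.1 hu.1
        have h2 := Metric.mem_closedBall.1 hv.1
        rw [← Real.dist_eq]
        linarith [dist_triangle_right u v x])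
    have hBm : MeasurableSet B := Metric.isClosed_closedBall.measurableSet
    have hμB : μ B ≤ ENNReal.ofReal ((2 * δ / δ0) ^ s) * μH[s] S.E := by
      rw [hμ, Measure.restrict_apply hBm]
      refine (measure_mono hsub).trans ((haus_upper hl' s hs.le S.E).trans ?_)
      gcongr
      exact (S.R_pos hl').le
    have hμH : ENNReal.ofReal ((c * δ * S.R τ) ^ s) * μH[s] S.E ≤ μ H := by
      rw [hμ, Measure.restrict_apply hHm, inter_eq_self_of_subset_left hHE]
      refine le_trans ?_ (haus_lower hlτ s hs.le S.E)
      rw [R_append]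
      gcongr
    have hκB : ENNReal.ofReal κ * μ B ≤ μ H := by
      refine le_trans ?_ hμH
      calc ENNReal.ofReal κ * μ B
          ≤ ENNReal.ofReal κ * (ENNReal.ofReal ((2 * δ / δ0) ^ s) * μH[s] S.E) := by gcongr
        _ = ENNReal.ofReal ((c * δ * S.R τ) ^ s) * μH[s] S.E := by
          rw [← mul_assoc, ← ENNReal.ofReal_mul hκ0.le, hκ,
            ← Real.mul_rpow (by positivity) (by positivity)]
          have e9 : c * S.R τ * (δ0 / 2) * (2 * δ / δ0) = c * δ * S.R τ := by field_simp
          rw [e9]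
    have hdis : Disjoint (F ∩ B) H := (hF l hl).mono_left inter_subset_left
    have hsum : μ (F ∩ B) + μ H ≤ μ B := by
      rw [← measure_union hdis hHm]
      exact measure_mono (union_subset inter_subset_right hHB)
    have hBpos : μ B ≠ 0 := by
      intro hz
      have : μ H = 0 := measure_mono_null hHB hz
      rw [this] at hμH
      have hp : 0 < (c * δ * S.R τ) ^ s := Real.rpow_pos_of_pos (by positivity) s
      have h9 := (ENNReal.ofReal_pos.2 hp).ne'
      simp only [nonpos_iff_eq_zero, mul_eq_zero] at hμH
      exact hμH.elim h9 h0
    have hBT : μ B ≠ ⊤ := measure_ne_top _ _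
    have e : ENNReal.ofReal κ = (ENNReal.ofReal κ * μ B) / μ B :=
      (ENNReal.mul_div_cancel_right hBpos hBT).symm
    rw [e, ← ENNReal.add_div]
    apply ENNReal.div_le_of_le_mul
    rw [one_mul]
    exact le_trans (by gcongr) hsum
  have hlim := hx.add_const (ENNReal.ofReal κ)
  have hev : ∀ᶠ δ in nhdsWithin (0:ℝ) (Ioi 0),
      μ (F ∩ Metric.closedBall x δ) / μ (Metric.closedBall x δ) + ENNReal.ofReal κ ≤ 1 := by
    filter_upwards [Ioc_mem_nhdsGT (zero_lt_one (α := ℝ))] with δ hδ using bound δ hδ.1 hδ.2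
  have h1 := le_of_tendsto hlim hev
  have h2 : (1 : ENNReal) < 1 + ENNReal.ofReal κ :=
    ENNReal.lt_add_right ENNReal.one_ne_top (ENNReal.ofReal_pos.2 hκ0).ne'
  exact absurd h1 (not_le.2 h2)

theorem expP (hS : S.goodE) : ∃ C : ℝ, 0 < C ∧ ∀ F ⊆ S.E,
    (∀ i, S.okd i → ∀ y ∈ S.E, S.f i y ∈ F → y ∈ F) →
    ∀ U ⊆ F, ∀ ε : ℝ, 0 < ε → (∀ x ∈ U, ∀ y ∈ U, |x - y| ≤ ε) →
      ∃ h : ℝ → ℝ, (∀ x y, |h x - h y| ≤ C * ε * |x - y|) ∧ U ⊆ h '' F := by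
  obtain ⟨δ0, hδ0, hexp⟩ := expand hS
  refine ⟨δ0⁻¹, inv_pos.2 hδ0, fun F hFE hF U hU ε hε hd => ?_⟩
  obtain ⟨l, hl, h1, h2⟩ := hexp F hFE hF U hU ε hε hd
  refine ⟨S.W l, fun x y => ?_, h1⟩
  rw [W_abs hl]
  apply mul_le_mul_of_nonneg_right _ (abs_nonneg _)
  rw [inv_mul_eq_div]; exact h2

end ClassE

theorem stmt19 (S : ClassE) (hS : S.goodE) :
    dimH (S.U 1) < dimH S.E ∧
      0 < μH[(dimH S.E).toReal] S.E ∧ μH[(dimH S.E).toReal] S.E < ⊤ := by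
  have hdT : dimH S.E ≠ ⊤ := by
    have : dimH S.E ≤ 1 := (dimH_mono (subset_univ _)).trans Real.dimH_univ.le
    exact ne_top_of_le_ne_top ENNReal.one_ne_top this
  have hdp := ClassE.dim_pos hS
  set s := (dimH S.E).toReal with hs_def
  have hs : 0 < s := ENNReal.toReal_pos hdp.ne' hdT
  have hsE : ENNReal.ofReal s = dimH S.E := ENNReal.ofReal_toReal hdT
  obtain ⟨C, hC, hexp⟩ := ClassE.expP hS
  have hpos : μH[s] S.E ≠ 0 := by
    intro h0
    have := aux_P S.E S.hEcpt C hC (hexp S.E subset_rfl (fun _ _ y hy _ => hy)) s hs h0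
    rw [hsE] at this
    exact lt_irrefl _ this
  have hfin : μH[s] S.E < ⊤ := by
    obtain ⟨c, hc, hc1, hcyl⟩ := ClassE.cylB S
    refine aux_fin S.E S.hEne S.hEcpt c hc hc1 ?_ s hs ?_
    · intro x hx δ hδ hδ1
      obtain ⟨l, hl, h1, h2⟩ := hcyl x hx δ hδ hδ1
      exact ⟨S.W l, S.R l, h1, fun y z => (ClassE.W_abs hl y z).ge, fun y hy => S.W_mem hl hy, h2⟩
    · intro t ht
      have ht0 : 0 < t := hs.trans ht
      have := hausdorffMeasure_of_dimH_lt (s := S.E) (d := Real.toNNReal t) (by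
        rw [← hsE]
        exact (ENNReal.ofReal_lt_ofReal_iff ht0).2 ht)
      rwa [Real.coe_toNNReal _ ht0.le] at this
  refine ⟨?_, pos_iff_ne_zero.2 hpos, hfin⟩
  -- the overlap
  obtain ⟨j, hj1, hj2, hjne⟩ := hS.2.2.1.2
  have hoj : S.okd j := ⟨hj1, by omega⟩
  have hoj' : S.okd (j + 1) := ⟨by omega, hj2⟩
  obtain ⟨x0, hx0⟩ := nonempty_iff_ne_empty.2 hjne
  obtain ⟨u, v, huv, -, -⟩ := ClassE.overlapD hS hj1 hj2
    (((ClassE.fI hoj' _).1 hx0.2).1.trans ((ClassE.fI hoj _).1 hx0.1).2)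
  set τ := j :: List.replicate u S.m with hτdef
  have hτ : S.ok τ := S.ok_cons.2 ⟨hoj, S.ok_rep S.okm u⟩
  have hτ' : S.ok ((j + 1) :: List.replicate v 1) := S.ok_cons.2 ⟨hoj', S.ok_rep S.ok1 v⟩
  set F : Set ℝ := {x | x ∈ S.E ∧ ∀ l, S.ok l → x ∉ Ioo (S.W (l ++ τ) S.a) (S.W (l ++ τ) S.b)}
    with hFdef
  have hFE : F ⊆ S.E := fun x hx => hx.1
  have hFcl : IsClosed F := by
    have : F = S.E ∩ ⋂ (l : List ℕ) (_ : S.ok l), (Ioo (S.W (l ++ τ) S.a) (S.W (l ++ τ) S.b))ᶜ := by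
      ext x; simp only [hFdef, mem_setOf_eq, mem_inter_iff, mem_iInter, mem_compl_iff]
    rw [this]
    exact S.hEcpt.isClosed.inter
      (isClosed_iInter fun l => isClosed_iInter fun _ => isOpen_Ioo.isClosed_compl)
  have hFc : IsCompact F := S.hEcpt.of_isClosed_subset hFcl hFE
  have hpull : ∀ i, S.okd i → ∀ y ∈ S.E, S.f i y ∈ F → y ∈ F := by
    intro i hi y hy hiy
    refine ⟨hy, fun l hl hmem => hiy.2 (i :: l) (S.ok_cons.2 ⟨hi, hl⟩) ?_⟩
    exact ⟨(S.f_smono hi).2 hmem.1, (S.f_smono hi).2 hmem.2⟩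
  have hUF : S.U 1 ⊆ F := by
    rintro x ⟨hxE, hx1⟩
    refine ⟨hxE, fun l hl hmem => ?_⟩
    have hlτ : S.ok (l ++ τ) := S.ok_append.2 ⟨hl, hτ⟩
    obtain ⟨z, hz, rfl⟩ := ClassE.claim_W hS hlτ hxE ((ClassE.WI hlτ x).2 ⟨hmem.1.le, hmem.2.le⟩)
    have htwo := ClassE.two_of_overlap (i := j) (j := j + 1) (by omega) hτ hτ' hz (congrFun huv z)
    obtain ⟨d, d', hne, h1, h2⟩ := ClassE.coding_two hl htwo
    rw [← hτdef, ← ClassE.W_append] at h1 h2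
    rw [Cardinal.eq_one_iff_unique] at hx1
    have hss := hx1.1
    exact hne (congrArg Subtype.val
      (Subsingleton.elim (⟨d, h1⟩ : S.codings (S.W (l ++ τ) z)) ⟨d', h2⟩))
  have hm3 := S.hm
  have ha1 : S.a < S.f S.m S.a := by
    have := ClassE.sepB hS (i := 1) le_rfl (j := S.m) (by omega) le_rfl
    have h2 := S.a_le (S.f_mem S.ok1 S.b_mem)
    linarith
  have hb1 : S.f 1 S.b < S.b := by
    have := ClassE.sepB hS (i := 1) le_rfl (j := S.m) (by omega) le_rfl
    have h2 := S.le_b (S.f_mem S.okm S.a_mem)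
    linarith
  have hnull : μH[s] F = 0 := by
    refine ClassE.null_F hS s hs hpos hfin.ne F hFE hFcl.measurableSet (τ ++ [1, S.m]) ?_ ?_
    · refine S.ok_append.2 ⟨hτ, S.ok_cons.2 ⟨S.ok1, S.ok_cons.2 ⟨S.okm, S.ok_nil⟩⟩⟩
    · intro l hl
      have hlτ : S.ok (l ++ τ) := S.ok_append.2 ⟨hl, hτ⟩
      rw [Set.disjoint_left]
      rintro x hxF ⟨y, hy, rfl⟩
      refine hxF.2 l hl ?_
      rw [← List.append_assoc, ClassE.W_append S (l ++ τ) [1, S.m] y]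
      have e : S.W [1, S.m] y = S.f 1 (S.f S.m y) := rfl
      rw [e]
      constructor
      · rw [S.W_smono hlτ]
        calc S.a = S.f 1 S.a := (ClassE.f1a hS).symm
          _ < S.f 1 (S.f S.m S.a) := (S.f_smono S.ok1).2 ha1
          _ ≤ _ := (S.f_mono S.ok1).2 ((S.f_mono S.okm).2 (S.a_le hy))
      · rw [S.W_smono hlτ]
        exact lt_of_le_of_lt ((S.f_mono S.ok1).2 (S.le_b (S.f_mem S.okm hy))) hb1
  have := aux_P F hFc C hC (hexp F hFE hpull) s hs hnull
  rw [hsE] at this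
  exact (dimH_mono hUF).trans_lt this
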